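/- arXiv:2510.03883 — 2 statements merged into one kernel-verified Lean document; each statement's English description precedes it below -/
import Mathlib

section
/- Let γ, λ₁, …, λ₉ be real numbers and f(x,y) = (1/3)(x − γy²)(x² + y⁴) + λ₁ + λ₂y + λ₃y² + λ₄y³ + λ₅y⁴ + λ₆x + λ₇xy + λ₈xy² + λ₉(x² + 3y⁴)y. Suppose every critical point of f is nondegenerate. Then the set of critical points of f is finite and has at most 10 elements; moreover, if m₋, m×, m₊ denote the numbers of local minima, saddles, and local maxima of f respectively, then m₋ − m× + m₊ = 0; in particular the total number m₋ + m× + m₊ of real critical points is even. -/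
/-- A point `p = (x₀, y₀)` is a critical point of `f : ℝ → ℝ → ℝ` if both
partial derivatives of `f` vanish at `p`. -/
def IsCriticalPt (f : ℝ → ℝ → ℝ) (p : ℝ × ℝ) : Prop :=
  deriv (fun t => f t p.2) p.1 = 0 ∧ deriv (fun t => f p.1 t) p.2 = 0

/-- The Hessian determinant `f_xx(p) * f_yy(p) - f_xy(p)^2` of `f` at `p`. -/
noncomputable def hessDet (f : ℝ → ℝ → ℝ) (p : ℝ × ℝ) : ℝ :=
  deriv (fun x => deriv (fun t => f t p.2) x) p.1 *
      deriv (fun y => deriv (fun t => f p.1 t) y) p.2 -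
    (deriv (fun y => deriv (fun t => f t y) p.1) p.2) ^ 2

/-- `p` is a local minimum point of the function `(x, y) ↦ f x y`. -/
def IsLocMin (f : ℝ → ℝ → ℝ) (p : ℝ × ℝ) : Prop :=
  IsLocalMin (fun q : ℝ × ℝ => f q.1 q.2) p

/-- `p` is a local maximum point of the function `(x, y) ↦ f x y`. -/
def IsLocMax (f : ℝ → ℝ → ℝ) (p : ℝ × ℝ) : Prop :=
  IsLocalMax (fun q : ℝ × ℝ => f q.1 q.2) p

/-- A saddle is a critical point that is neither a local minimum
nor a local maximum. -/
def IsSaddle (f : ℝ → ℝ → ℝ) (p : ℝ × ℝ) : Prop :=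
  IsCriticalPt f p ∧ ¬ IsLocMin f p ∧ ¬ IsLocMax f p

/-- The canonical versal deformation of the real singularity class `J₁₀¹`. -/
noncomputable def J1vers (γ l1 l2 l3 l4 l5 l6 l7 l8 l9 : ℝ) : ℝ → ℝ → ℝ := fun x y =>
  (1 / 3) * (x - γ * y ^ 2) * (x ^ 2 + y ^ 4) + l1 + l2 * y + l3 * y ^ 2 + l4 * y ^ 3 +
      l5 * y ^ 4 + l6 * x + l7 * x * y + l8 * x * y ^ 2 + l9 * (x ^ 2 + 3 * y ^ 4) * y

open Polynomial Filter Topology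

/-- A step function vanishing near `±∞`, whose jumps are given by `J` and take place in a finite
set, has total jump zero. -/
theorem sum_jump_eq_zero (F J : ℝ → ℤ) (S : Finset ℝ) (hJ : ∀ y ∉ S, J y = 0)
    (hloc : ∀ y, ∃ α β : ℤ, (∀ᶠ z in 𝓝[<] y, F z = α) ∧ (∀ᶠ z in 𝓝[>] y, F z = β) ∧
      β - α = J y)
    (htop : ∀ᶠ z in atTop, F z = 0) (hbot : ∀ᶠ z in atBot, F z = 0) :
    ∑ y ∈ S, J y = 0 := by
  classical
  set G : ℝ → ℤ := fun z => F z - ∑ s ∈ S, if s < z then J s else 0 with hG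
  have hstep : ∀ y, ∃ c : ℤ, ∀ᶠ z in 𝓝[≠] y, G z = c := by
    intro y
    obtain ⟨α, β, hα, hβ, hαβ⟩ := hloc y
    have hcmp : ∀ s ∈ S, ∀ᶠ z in 𝓝 y, s ≠ y → (s < z ↔ s < y) := by
      intro s _
      rcases lt_trichotomy s y with h | h | h
      · filter_upwards [lt_mem_nhds h] with z hz _
        exact ⟨fun _ => h, fun _ => hz⟩
      · exact Eventually.of_forall fun z h' => absurd h h'
      · filter_upwards [gt_mem_nhds h] with z hz _
        exact ⟨fun h' => absurd h' hz.not_gt, fun h' => absurd h' h.not_gt⟩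
    have hall : ∀ᶠ z in 𝓝 y, ∀ s ∈ S, s ≠ y → (s < z ↔ s < y) :=
      (eventually_all_finset S).2 hcmp
    set B : ℤ := ∑ s ∈ S, if s < y then J s else 0
    refine ⟨α - B, ?_⟩
    rw [← nhdsLT_sup_nhdsGT, eventually_sup]
    constructor
    · filter_upwards [hα, nhdsWithin_le_nhds hall, self_mem_nhdsWithin] with z hz hs hzy
      have hzy : z < y := hzy
      rw [hG]
      simp only [hz]
      congr 1
      refine Finset.sum_congr rfl fun s hsS => ?_
      by_cases h : s = y
      · subst h
        simp [hzy.not_gt]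
      · simp [hs s hsS h]
    · filter_upwards [hβ, nhdsWithin_le_nhds hall, self_mem_nhdsWithin] with z hz hs hzy
      have hzy : y < z := hzy
      have hsum : ∑ s ∈ S, (if s < z then J s else 0) = B + J y := by
        have hJy : J y = ∑ s ∈ S, if s = y then J s else 0 := by
          rw [Finset.sum_ite_eq']
          split_ifs with h
          · rfl
          · exact hJ y h
        rw [hJy, ← Finset.sum_add_distrib]
        refine Finset.sum_congr rfl fun s hsS => ?_
        by_cases h : s = y
        · subst h
          simp [hzy]
        · simp [hs s hsS h, h]
      rw [hG]
      simp only [hz, hsum]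
      linarith
  choose c hc using hstep
  have hlc : IsLocallyConstant c := by
    rw [IsLocallyConstant.iff_eventually_eq]
    intro y
    have h1 : ∀ᶠ z in 𝓝[≠] y, ∀ᶠ w in 𝓝[≠] z, G w = c y := by
      have := eventually_eventually_nhdsWithin.2 (hc y)
      filter_upwards [this, self_mem_nhdsWithin] with z hz hzy
      have hmem : ({y}ᶜ : Set ℝ) ∈ 𝓝 z := isOpen_compl_singleton.mem_nhds hzy
      rw [nhdsWithin_eq_nhds.2 hmem] at hz
      exact nhdsWithin_le_nhds hz
    have h2 : ∀ᶠ z in 𝓝[≠] y, c z = c y := by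
      filter_upwards [h1] with z hz
      obtain ⟨w, hw1, hw2⟩ := (hz.and (hc z)).exists
      exact hw2.symm.trans hw1
    rw [eventually_nhdsWithin_iff] at h2
    filter_upwards [h2] with z hz
    by_cases h : z = y
    · rw [h]
    · exact hz h
  have hconst : ∀ x y, c x = c y := fun x y => hlc.apply_eq_of_preconnectedSpace x y
  have key : ∀ (l : ℤ) (t : Set ℝ), IsOpen t → t.Nonempty → (∀ z ∈ t, G z = l) → c 0 = l := by
    rintro l t ht ⟨z, hz⟩ hl
    rw [hconst 0 z]
    have : ∀ᶠ w in 𝓝[≠] z, G w = l :=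
      nhdsWithin_le_nhds (mem_of_superset (ht.mem_nhds hz) hl)
    obtain ⟨w, hw1, hw2⟩ := ((hc z).and this).exists
    exact hw1.symm.trans hw2
  have hc_bot : c 0 = 0 := by
    have hb : ∀ᶠ z in atBot, ∀ s ∈ S, z < s :=
      (eventually_all_finset S).2 fun s _ => eventually_lt_atBot s
    obtain ⟨M, hM⟩ := eventually_atBot.1 (hbot.and hb)
    refine key 0 (Set.Iio M) isOpen_Iio ⟨M - 1, by simp⟩ fun z hz => ?_
    obtain ⟨h1, h2⟩ := hM z (le_of_lt hz)
    simp only [hG, h1, zero_sub, neg_eq_zero]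
    exact Finset.sum_eq_zero fun s hs => by simp [(h2 s hs).not_gt]
  have hc_top : c 0 = -∑ s ∈ S, J s := by
    have hb : ∀ᶠ z in atTop, ∀ s ∈ S, s < z :=
      (eventually_all_finset S).2 fun s _ => eventually_gt_atTop s
    obtain ⟨M, hM⟩ := eventually_atTop.1 (htop.and hb)
    refine key _ (Set.Ioi M) isOpen_Ioi ⟨M + 1, by simp⟩ fun z hz => ?_
    obtain ⟨h1, h2⟩ := hM z (le_of_lt hz)
    simp only [hG, h1, zero_sub, neg_inj]
    exact Finset.sum_congr rfl fun s hs => by simp [h2 s hs]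
  linarith

theorem Polynomial.exists_eq_X_sub_C_mul {p : ℝ[X]} {a : ℝ} (h : p.eval a = 0) :
    ∃ r : ℝ[X], p = (X - C a) * r ∧ r.eval a = (derivative p).eval a := by
  obtain ⟨r, rfl⟩ := dvd_iff_isRoot.2 h
  exact ⟨r, rfl, by simp⟩

theorem Polynomial.exists_taylor_two (p : ℝ[X]) (a : ℝ) :
    ∃ r : ℝ[X], (∀ y, p.eval y = p.eval a + (derivative p).eval a * (y - a) +
      r.eval y * (y - a) ^ 2) ∧ 2 * r.eval a = (derivative (derivative p)).eval a := by
  obtain ⟨s, hs, hsa⟩ := exists_eq_X_sub_C_mul (p := p - C (p.eval a)) (a := a) (by simp)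
  obtain ⟨r, hr, -⟩ := exists_eq_X_sub_C_mul (p := s - C (s.eval a)) (a := a) (by simp)
  have hs' : (derivative p).eval a = s.eval a := by simp [hsa]
  have hp : p = C (p.eval a) + C (s.eval a) * (X - C a) + r * (X - C a) ^ 2 := by
    linear_combination hs + (X - C a) * hr
  refine ⟨r, fun y => ?_, ?_⟩
  · have := congrArg (eval y) hp
    simpa [hs'] using this
  · have := congrArg (fun q => eval a (derivative (derivative q))) hp
    simp [pow_two] at this
    linarith

theorem not_isLocalMax_of_path {φ : ℝ × ℝ → ℝ} {p : ℝ × ℝ} {c : ℝ → ℝ × ℝ} {w : ℝ → ℝ}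
    (hc : Continuous c) (hc0 : c 0 = p) (hw : Continuous w)
    (h : ∀ t, φ (c t) - φ p = t ^ 2 * w t) (hpos : 0 < w 0) : ¬ IsLocalMax φ p := by
  intro hmax
  have h1 : ∀ᶠ t in 𝓝 (0 : ℝ), φ (c t) ≤ φ p := by
    have := hc.tendsto 0
    rw [hc0] at this
    exact this.eventually hmax
  have h2 : ∀ᶠ t in 𝓝 (0 : ℝ), 0 < w t := hw.continuousAt.eventually (lt_mem_nhds hpos)
  have h12 : ∀ᶠ t in 𝓝[≠] (0 : ℝ), φ (c t) ≤ φ p ∧ 0 < w t := nhdsWithin_le_nhds (h1.and h2)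
  obtain ⟨t, ⟨h3, h4⟩, ht⟩ := (h12.and self_mem_nhdsWithin).exists
  have ht' : 0 < t ^ 2 := by
    have : t ≠ 0 := ht
    positivity
  have := h t
  nlinarith [mul_pos ht' h4]

theorem not_isLocalMin_of_path {φ : ℝ × ℝ → ℝ} {p : ℝ × ℝ} {c : ℝ → ℝ × ℝ} {w : ℝ → ℝ}
    (hc : Continuous c) (hc0 : c 0 = p) (hw : Continuous w)
    (h : ∀ t, φ (c t) - φ p = t ^ 2 * w t) (hneg : w 0 < 0) : ¬ IsLocalMin φ p := by
  intro hmin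
  refine not_isLocalMax_of_path (φ := fun q => -φ q) (w := fun t => -w t) hc hc0 hw.neg
    (fun t => ?_) (neg_pos.2 hneg) hmin.neg
  linear_combination -h t

theorem exists_quadraticForm_pos {a b c : ℝ} (h : 4 * a * c - b ^ 2 < 0) :
    ∃ s t : ℝ, 0 < a * s ^ 2 + b * (s * t) + c * t ^ 2 := by
  rcases lt_trichotomy a 0 with ha | ha | ha
  · refine ⟨-b, 2 * a, ?_⟩
    have := mul_pos_of_neg_of_neg ha h
    nlinarith
  · have hb : b ≠ 0 := by
      rintro rfl
      simp [ha] at h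
    refine ⟨(1 - c) / b, 1, ?_⟩
    rw [ha]
    have : b * ((1 - c) / b * 1) = 1 - c := by field_simp
    rw [this]
    norm_num
  · exact ⟨1, 0, by simpa using ha⟩

/-- The cubic `u³ / 3 + P(y) u + Q(y)` in the coordinates `u = x - b(y)` and `y`. -/
noncomputable def fiberedCubic (b P Q : ℝ[X]) : ℝ → ℝ → ℝ := fun x y =>
  (x - b.eval y) ^ 3 / 3 + P.eval y * (x - b.eval y) + Q.eval y

/-- The Hessian determinant of `u³ / 3 + P(y) u + Q(y)` with respect to `(u, y)`. -/
noncomputable def cubicHess (P Q : ℝ[X]) (u y : ℝ) : ℝ :=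
  2 * u * ((derivative (derivative P)).eval y * u + (derivative (derivative Q)).eval y) -
    (derivative P).eval y ^ 2

/-- The resultant of `u² + P` and `P' u + Q'` with respect to `u`. -/
noncomputable def cubicResultant (P Q : ℝ[X]) : ℝ[X] :=
  derivative Q ^ 2 + P * derivative P ^ 2

/-- The values of `u` at the critical points of `u³ / 3 + P(y) u + Q(y)` at height `y`. -/
noncomputable def critFiber (P Q : ℝ[X]) (y : ℝ) : Finset ℝ :=
  ((X ^ 2 + C (P.eval y) : ℝ[X]).roots.toFinset).filter
    fun u => (derivative P).eval y * u + (derivative Q).eval y = 0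

theorem mem_critFiber {P Q : ℝ[X]} {y u : ℝ} : u ∈ critFiber P Q y ↔
    u ^ 2 + P.eval y = 0 ∧ (derivative P).eval y * u + (derivative Q).eval y = 0 := by
  simp [critFiber, (monic_X_pow_add_C (P.eval y) two_ne_zero).ne_zero]

theorem eval_cubicResultant (P Q : ℝ[X]) (y : ℝ) : (cubicResultant P Q).eval y =
    (derivative Q).eval y ^ 2 + P.eval y * (derivative P).eval y ^ 2 := by
  simp [cubicResultant]

theorem hasDerivAt_fiberedCubic_fst (b P Q : ℝ[X]) (x y : ℝ) :
    HasDerivAt (fun t => fiberedCubic b P Q t y) ((x - b.eval y) ^ 2 + P.eval y) x := by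
  have h := (hasDerivAt_id x).sub_const (b.eval y)
  refine ((((h.pow 3).div_const 3).add (h.const_mul (P.eval y))).add_const
    (Q.eval y)).congr_deriv ?_
  simp

theorem hasDerivAt_fiberedCubic_snd (b P Q : ℝ[X]) (x y : ℝ) :
    HasDerivAt (fun t => fiberedCubic b P Q x t)
      (-(derivative b).eval y * ((x - b.eval y) ^ 2 + P.eval y) +
        (derivative P).eval y * (x - b.eval y) + (derivative Q).eval y) y := by
  have h := (b.hasDerivAt y).const_sub x
  refine ((((h.pow 3).div_const 3).add ((P.hasDerivAt y).mul h)).add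
    (Q.hasDerivAt y)).congr_deriv ?_
  simp
  ring

theorem isCriticalPt_fiberedCubic {b P Q : ℝ[X]} {p : ℝ × ℝ} :
    IsCriticalPt (fiberedCubic b P Q) p ↔ p.1 - b.eval p.2 ∈ critFiber P Q p.2 := by
  rw [IsCriticalPt, (hasDerivAt_fiberedCubic_fst b P Q p.1 p.2).deriv,
    (hasDerivAt_fiberedCubic_snd b P Q p.1 p.2).deriv, mem_critFiber]
  refine and_congr_right fun h => ?_
  rw [h]
  simp

theorem hessDet_fiberedCubic {b P Q : ℝ[X]} {p : ℝ × ℝ}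
    (hp : IsCriticalPt (fiberedCubic b P Q) p) :
    hessDet (fiberedCubic b P Q) p = cubicHess P Q (p.1 - b.eval p.2) p.2 := by
  obtain ⟨h1, h2⟩ := mem_critFiber.1 (isCriticalPt_fiberedCubic.1 hp)
  obtain ⟨x, y⟩ := p
  simp only at h1 h2
  have hu := (b.hasDerivAt y).const_sub x
  have hxx : HasDerivAt (fun t => (t - b.eval y) ^ 2 + P.eval y) (2 * (x - b.eval y)) x := by
    refine ((((hasDerivAt_id x).sub_const (b.eval y)).pow 2).add_const (P.eval y)).congr_deriv ?_
    simp
  have hxy : HasDerivAt (fun t => (x - b.eval t) ^ 2 + P.eval t)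
      (-2 * (derivative b).eval y * (x - b.eval y) + (derivative P).eval y) y := by
    refine ((hu.pow 2).add (P.hasDerivAt y)).congr_deriv ?_
    simp
    ring
  have hyy := (((((derivative b).hasDerivAt y).neg).mul hxy).add
    (((derivative P).hasDerivAt y).mul hu)).add ((derivative Q).hasDerivAt y)
  simp only [hessDet, (hasDerivAt_fiberedCubic_fst b P Q _ _).deriv,
    (hasDerivAt_fiberedCubic_snd b P Q _ _).deriv]
  rw [hxx.deriv, hxy.deriv]
  erw [hyy.deriv]
  simp only [cubicHess, Pi.neg_apply]
  linear_combination (-2 * (x - b.eval y) * (derivative (derivative b)).eval y) * h1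

/-- The quadratic part, with continuous coefficients, of the cubic at a critical point. -/
theorem fiberedCubic_expansion {b P Q : ℝ[X]} {p : ℝ × ℝ}
    (hp : IsCriticalPt (fiberedCubic b P Q) p) :
    ∃ A B : ℝ × ℝ → ℝ, ∃ m : ℝ, Continuous A ∧ Continuous B ∧
      4 * A p * B p - m ^ 2 = cubicHess P Q (p.1 - b.eval p.2) p.2 ∧
      ∀ q : ℝ × ℝ, fiberedCubic b P Q q.1 q.2 - fiberedCubic b P Q p.1 p.2 =
        A q * ((q.1 - b.eval q.2) - (p.1 - b.eval p.2)) ^ 2 +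
        m * (((q.1 - b.eval q.2) - (p.1 - b.eval p.2)) * (q.2 - p.2)) +
        B q * (q.2 - p.2) ^ 2 := by
  obtain ⟨h1, h2⟩ := mem_critFiber.1 (isCriticalPt_fiberedCubic.1 hp)
  obtain ⟨r, hr, hr'⟩ := P.exists_taylor_two p.2
  obtain ⟨s, hs, hs'⟩ := Q.exists_taylor_two p.2
  refine ⟨fun q => (p.1 - b.eval p.2) + ((q.1 - b.eval q.2) - (p.1 - b.eval p.2)) / 3,
    fun q => r.eval q.2 * (q.1 - b.eval q.2) + s.eval q.2, (derivative P).eval p.2,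
    by fun_prop, by fun_prop, ?_, fun q => ?_⟩
  · simp only [cubicHess]
    rw [← hr', ← hs']
    ring
  · simp only [fiberedCubic]
    rw [hr q.2, hs q.2]
    linear_combination (q.1 - b.eval q.2 - (p.1 - b.eval p.2)) * h1 + (q.2 - p.2) * h2

theorem exists_path_fiberedCubic {b P Q : ℝ[X]} {p : ℝ × ℝ} {A B : ℝ × ℝ → ℝ} {m : ℝ}
    (hA : Continuous A) (hB : Continuous B)
    (h : ∀ q : ℝ × ℝ, fiberedCubic b P Q q.1 q.2 - fiberedCubic b P Q p.1 p.2 =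
        A q * ((q.1 - b.eval q.2) - (p.1 - b.eval p.2)) ^ 2 +
        m * (((q.1 - b.eval q.2) - (p.1 - b.eval p.2)) * (q.2 - p.2)) +
        B q * (q.2 - p.2) ^ 2) (s t : ℝ) :
    ∃ (c : ℝ → ℝ × ℝ) (w : ℝ → ℝ), Continuous c ∧ c 0 = p ∧ Continuous w ∧
      (∀ z, (fun q : ℝ × ℝ => fiberedCubic b P Q q.1 q.2) (c z) -
        (fun q : ℝ × ℝ => fiberedCubic b P Q q.1 q.2) p = z ^ 2 * w z) ∧
      w 0 = A p * s ^ 2 + m * (s * t) + B p * t ^ 2 := by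
  let c : ℝ → ℝ × ℝ := fun z =>
    (b.eval (p.2 + z * t) + (p.1 - b.eval p.2) + z * s, p.2 + z * t)
  have hc : Continuous c := by fun_prop
  have hc0 : c 0 = p := by ext <;> simp [c]
  refine ⟨c, fun z => A (c z) * s ^ 2 + m * (s * t) + B (c z) * t ^ 2, hc, hc0, by fun_prop,
    fun z => ?_, by simp [hc0]⟩
  simp only [h (c z)]
  simp only [c]
  ring

theorem isLocMin_of_expansion {f : ℝ → ℝ → ℝ} {p : ℝ × ℝ} {A B h k : ℝ × ℝ → ℝ} {m : ℝ}
    (hA : Continuous A) (hB : Continuous B)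
    (hf : ∀ q : ℝ × ℝ, f q.1 q.2 - f p.1 p.2 =
      A q * h q ^ 2 + m * (h q * k q) + B q * k q ^ 2)
    (hpos : 0 < A p) (hdet : 0 < 4 * A p * B p - m ^ 2) : IsLocMin f p := by
  have h1 : ∀ᶠ q in 𝓝 p, 0 < A q := hA.continuousAt.eventually (lt_mem_nhds hpos)
  have h2 : ∀ᶠ q in 𝓝 p, 0 < 4 * A q * B q - m ^ 2 := by
    have : Continuous fun q => 4 * A q * B q - m ^ 2 := by fun_prop
    exact this.continuousAt.eventually (lt_mem_nhds hdet)
  filter_upwards [h1, h2] with q hq1 hq2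
  have h3 : 0 ≤ 4 * A q * (f q.1 q.2 - f p.1 p.2) := by
    rw [hf q]
    have : 0 ≤ (2 * A q * h q + m * k q) ^ 2 + (4 * A q * B q - m ^ 2) * k q ^ 2 := by positivity
    linarith
  have h4 := nonneg_of_mul_nonneg_right h3 (by positivity)
  linarith

theorem isLocMin_xor_isLocMax {b P Q : ℝ[X]} {p : ℝ × ℝ}
    (hp : IsCriticalPt (fiberedCubic b P Q) p)
    (hH : 0 < cubicHess P Q (p.1 - b.eval p.2) p.2) :
    (IsLocMin (fiberedCubic b P Q) p ∧ ¬ IsLocMax (fiberedCubic b P Q) p) ∨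
      (IsLocMax (fiberedCubic b P Q) p ∧ ¬ IsLocMin (fiberedCubic b P Q) p) := by
  obtain ⟨A, B, m, hA, hB, hdet, hexp⟩ := fiberedCubic_expansion hp
  obtain ⟨c, w, hc, hc0, hw, hcw, hw0⟩ := exists_path_fiberedCubic hA hB hexp 1 0
  rw [← hdet] at hH
  rcases lt_trichotomy (A p) 0 with ha | ha | ha
  · refine Or.inr ⟨?_, not_isLocalMin_of_path hc hc0 hw hcw (by simpa [hw0] using ha)⟩
    have : IsLocMin (fun x y => -fiberedCubic b P Q x y) p := by
      refine isLocMin_of_expansion (A := fun q => -A q) (B := fun q => -B q) (m := -m)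
        (h := fun q => (q.1 - b.eval q.2) - (p.1 - b.eval p.2)) (k := fun q => q.2 - p.2)
        hA.neg hB.neg (fun q => ?_) (neg_pos.2 ha) (by nlinarith)
      linear_combination -hexp q
    simpa [IsLocMin, IsLocMax] using IsLocalMin.neg this
  · rw [ha] at hH
    nlinarith [sq_nonneg m]
  · exact Or.inl ⟨isLocMin_of_expansion hA hB hexp ha hH,
      not_isLocalMax_of_path hc hc0 hw hcw (by simpa [hw0] using ha)⟩

theorem isSaddle_of_cubicHess_neg {b P Q : ℝ[X]} {p : ℝ × ℝ}
    (hp : IsCriticalPt (fiberedCubic b P Q) p)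
    (hH : cubicHess P Q (p.1 - b.eval p.2) p.2 < 0) : IsSaddle (fiberedCubic b P Q) p := by
  obtain ⟨A, B, m, hA, hB, hdet, hexp⟩ := fiberedCubic_expansion hp
  rw [← hdet] at hH
  refine ⟨hp, ?_, ?_⟩
  · obtain ⟨s, t, hst⟩ := exists_quadraticForm_pos (a := -A p) (b := -m) (c := -B p)
      (by nlinarith)
    obtain ⟨c, w, hc, hc0, hw, hcw, hw0⟩ := exists_path_fiberedCubic hA hB hexp s t
    exact not_isLocalMin_of_path hc hc0 hw hcw (by linarith)
  · obtain ⟨s, t, hst⟩ := exists_quadraticForm_pos hH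
    obtain ⟨c, w, hc, hc0, hw, hcw, hw0⟩ := exists_path_fiberedCubic hA hB hexp s t
    exact not_isLocalMax_of_path hc hc0 hw hcw (by linarith)

/-- The step function on the `y`-axis whose jumps count the critical points. -/
noncomputable def cubicStep (P Q : ℝ[X]) (y : ℝ) : ℤ :=
  if (cubicResultant P Q).eval y < 0 then SignType.sign ((derivative P).eval y) else 0

theorem Polynomial.eventually_eval_pos {p : ℝ[X]} {a : ℝ} (h : 0 < p.eval a) :
    ∀ᶠ y in 𝓝 a, 0 < p.eval y :=
  p.continuous.continuousAt.eventually (lt_mem_nhds h)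

theorem Polynomial.eventually_eval_neg {p : ℝ[X]} {a : ℝ} (h : p.eval a < 0) :
    ∀ᶠ y in 𝓝 a, p.eval y < 0 :=
  p.continuous.continuousAt.eventually (gt_mem_nhds h)

theorem Polynomial.eventually_sign_eval {p : ℝ[X]} {a : ℝ} (h : p.eval a ≠ 0) :
    ∀ᶠ y in 𝓝 a, SignType.sign (p.eval y) = SignType.sign (p.eval a) := by
  rcases h.lt_or_gt with h | h
  · filter_upwards [eventually_eval_neg h] with y hy
    rw [sign_neg h, sign_neg hy]
  · filter_upwards [eventually_eval_pos h] with y hy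
    rw [sign_pos h, sign_pos hy]

theorem critFiber_eq_empty {P Q : ℝ[X]} {y : ℝ} (h : (cubicResultant P Q).eval y ≠ 0) :
    critFiber P Q y = ∅ := by
  refine Finset.eq_empty_of_forall_notMem fun u hu => h ?_
  obtain ⟨h1, h2⟩ := mem_critFiber.1 hu
  rw [eval_cubicResultant]
  linear_combination ((derivative Q).eval y - (derivative P).eval y * u) * h2 +
    (derivative P).eval y ^ 2 * h1

theorem critFiber_eq_singleton {P Q : ℝ[X]} {y : ℝ} (h : (cubicResultant P Q).eval y = 0)
    (hP : (derivative P).eval y ≠ 0) :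
    critFiber P Q y = {-(derivative Q).eval y / (derivative P).eval y} := by
  ext u
  rw [mem_critFiber, Finset.mem_singleton, eq_div_iff hP]
  rw [eval_cubicResultant] at h
  constructor
  · rintro ⟨-, h2⟩
    linarith
  · intro hu
    refine ⟨?_, by linarith⟩
    have : (derivative P).eval y ^ 2 * (u ^ 2 + P.eval y) = 0 := by
      linear_combination h + (u * (derivative P).eval y - (derivative Q).eval y) * hu
    simpa [hP] using this

theorem derivative_cubicResultant_eval {P Q : ℝ[X]} {y u : ℝ} (hu : u ∈ critFiber P Q y) :
    (derivative (cubicResultant P Q)).eval y =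
      -(derivative P).eval y * cubicHess P Q u y := by
  obtain ⟨h1, h2⟩ := mem_critFiber.1 hu
  simp only [cubicResultant, cubicHess, derivative_add, derivative_mul, derivative_pow, eval_add,
    eval_mul, eval_pow, eval_C, Nat.cast_ofNat, Nat.add_one_sub_one, pow_one]
  linear_combination (2 * (derivative (derivative Q)).eval y) * h2 +
    (2 * (derivative P).eval y * (derivative (derivative P)).eval y) * h1

/-- At a common zero of `P'` and `Q'` the resultant vanishes to second order. -/
theorem exists_cubicResultant_eq_sq_mul {P Q : ℝ[X]} {a : ℝ}
    (hP : (derivative P).eval a = 0) (hQ : (derivative Q).eval a = 0) :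
    ∃ s r : ℝ[X], derivative P = (X - C a) * s ∧ cubicResultant P Q = (X - C a) ^ 2 * r ∧
      s.eval a = (derivative (derivative P)).eval a ∧
      r.eval a = (derivative (derivative Q)).eval a ^ 2 +
        P.eval a * (derivative (derivative P)).eval a ^ 2 := by
  obtain ⟨s, hs, hsa⟩ := exists_eq_X_sub_C_mul hP
  obtain ⟨t, ht, hta⟩ := exists_eq_X_sub_C_mul hQ
  refine ⟨s, t ^ 2 + P * s ^ 2, hs, ?_, hsa, by simp [hsa, hta]⟩
  rw [cubicResultant]
  linear_combination (derivative Q + (X - C a) * t) * ht + P * (derivative P + (X - C a) * s) * hs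

theorem critFiber_eq_empty_of_pos {P Q : ℝ[X]} {y : ℝ} (hP : 0 < P.eval y) :
    critFiber P Q y = ∅ := by
  refine Finset.eq_empty_of_forall_notMem fun u hu => ?_
  nlinarith [(mem_critFiber.1 hu).1, sq_nonneg u]

theorem critFiber_eq_pair {P Q : ℝ[X]} {y : ℝ} (hP : P.eval y < 0)
    (hP' : (derivative P).eval y = 0) (hQ' : (derivative Q).eval y = 0) :
    critFiber P Q y = {√(-P.eval y), -√(-P.eval y)} := by
  ext u
  have h := Real.sq_sqrt (neg_nonneg.2 hP.le)
  rw [mem_critFiber, Finset.mem_insert, Finset.mem_singleton, hP', hQ', ← sq_eq_sq_iff_eq_or_eq_neg,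
    h]
  simp [eq_neg_iff_add_eq_zero]

theorem neg_of_nondegenerate {P Q : ℝ[X]} {y : ℝ}
    (hnd : ∀ u ∈ critFiber P Q y, cubicHess P Q u y ≠ 0)
    (hP' : (derivative P).eval y = 0) (hQ' : (derivative Q).eval y = 0) (hP : ¬ 0 < P.eval y) :
    P.eval y < 0 := by
  refine lt_of_le_of_ne (not_lt.1 hP) fun h => hnd 0 ?_ ?_
  · simp [mem_critFiber, h, hQ']
  · simp [cubicHess, hP']

theorem card_critFiber_le {P Q : ℝ[X]} {y : ℝ} (hR : cubicResultant P Q ≠ 0)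
    (hnd : ∀ u ∈ critFiber P Q y, cubicHess P Q u y ≠ 0) :
    (critFiber P Q y).card ≤ (cubicResultant P Q).roots.count y := by
  rw [count_roots]
  by_cases h : (cubicResultant P Q).eval y = 0
  swap
  · simp [critFiber_eq_empty h]
  by_cases hP' : (derivative P).eval y = 0
  · have hQ' : (derivative Q).eval y = 0 := by simpa [eval_cubicResultant, hP'] using h
    by_cases hP : 0 < P.eval y
    · simp [critFiber_eq_empty_of_pos hP]
    rw [critFiber_eq_pair (neg_of_nondegenerate hnd hP' hQ' hP) hP' hQ']
    obtain ⟨s, r, -, hr, -⟩ := exists_cubicResultant_eq_sq_mul hP' hQ'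
    exact Finset.card_le_two.trans ((le_rootMultiplicity_iff hR).2 ⟨r, hr⟩)
  · rw [critFiber_eq_singleton h hP', Finset.card_singleton]
    exact (rootMultiplicity_pos hR).2 h

/-- The jump of `cubicStep` at `a` is the sum of the signs of the Hessian determinants of the
critical points at height `a`. -/
theorem jump_cubicStep {P Q : ℝ[X]} {a : ℝ}
    (hnd : ∀ u ∈ critFiber P Q a, cubicHess P Q u a ≠ 0) :
    ∃ α β : ℤ, (∀ᶠ z in 𝓝[<] a, cubicStep P Q z = α) ∧ (∀ᶠ z in 𝓝[>] a, cubicStep P Q z = β) ∧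
      β - α = ∑ u ∈ critFiber P Q a, (SignType.sign (cubicHess P Q u a) : ℤ) := by
  have of_nhds : ∀ α : ℤ, (∀ᶠ z in 𝓝 a, cubicStep P Q z = α) →
      0 = ∑ u ∈ critFiber P Q a, (SignType.sign (cubicHess P Q u a) : ℤ) →
      ∃ α β : ℤ, (∀ᶠ z in 𝓝[<] a, cubicStep P Q z = α) ∧
        (∀ᶠ z in 𝓝[>] a, cubicStep P Q z = β) ∧
        β - α = ∑ u ∈ critFiber P Q a, (SignType.sign (cubicHess P Q u a) : ℤ) :=
    fun α h h0 => ⟨α, α, nhdsWithin_le_nhds h, nhdsWithin_le_nhds h, by rw [sub_self, h0]⟩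
  rcases lt_trichotomy ((cubicResultant P Q).eval a) 0 with hR | hR | hR
  · have hP' : (derivative P).eval a ≠ 0 := by
      intro h
      rw [eval_cubicResultant, h] at hR
      nlinarith [sq_nonneg ((derivative Q).eval a)]
    refine of_nhds (SignType.sign ((derivative P).eval a)) ?_ (by simp [critFiber_eq_empty hR.ne])
    filter_upwards [eventually_eval_neg hR, eventually_sign_eval hP'] with z h1 h2
    rw [cubicStep, if_pos h1, h2]
  · by_cases hP' : (derivative P).eval a = 0
    · have hQ' : (derivative Q).eval a = 0 := by simpa [eval_cubicResultant, hP'] using hR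
      by_cases hP : 0 < P.eval a
      · refine of_nhds 0 ?_ (by simp [critFiber_eq_empty_of_pos hP])
        filter_upwards [eventually_eval_pos hP] with z hz
        refine if_neg (not_lt.2 ?_)
        rw [eval_cubicResultant]
        positivity
      have hP := neg_of_nondegenerate hnd hP' hQ' hP
      obtain ⟨s, r, hs, hr, hsa, hra⟩ := exists_cubicResultant_eq_sq_mul hP' hQ'
      set v := √(-P.eval a) with hv
      have hv0 : 0 < v := Real.sqrt_pos.2 (neg_pos.2 hP)
      have hv2 : v ^ 2 = -P.eval a := Real.sq_sqrt (neg_nonneg.2 hP.le)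
      have hfib := critFiber_eq_pair hP hP' hQ'
      rw [← hv] at hfib
      have hsum : ∑ u ∈ critFiber P Q a, (SignType.sign (cubicHess P Q u a) : ℤ) =
          SignType.sign (cubicHess P Q v a) + SignType.sign (cubicHess P Q (-v) a) := by
        rw [hfib, Finset.sum_pair (by linarith)]
      have hne1 := hnd v (by simp [hfib])
      have hne2 := hnd (-v) (by simp [hfib])
      have hH : ∀ u, cubicHess P Q u a = 2 * u * (s.eval a * u +
          (derivative (derivative Q)).eval a) := by
        intro u
        simp [cubicHess, hP', hsa]
      rw [hH] at hne1 hne2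
      rw [hsum, hH, hH]
      rw [hsum, hH, hH] at of_nhds
      rw [← hsa] at hra
      have hrv : r.eval a = -((s.eval a * v + (derivative (derivative Q)).eval a) *
          (s.eval a * v - (derivative (derivative Q)).eval a)) := by
        rw [hra]
        linear_combination s.eval a ^ 2 * hv2
      generalize (derivative (derivative Q)).eval a = w at *
      have e1 : SignType.sign (2 * v * (s.eval a * v + w)) =
          SignType.sign (s.eval a * v + w) := by
        rw [sign_mul, sign_pos (by positivity), one_mul]
      have e2 : SignType.sign (2 * -v * (s.eval a * -v + w)) =
          SignType.sign (s.eval a * v - w) := by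
        rw [show 2 * -v * (s.eval a * -v + w) = (2 * v) * (s.eval a * v - w) by ring, sign_mul,
          sign_pos (by positivity), one_mul]
      have hn1 : s.eval a * v + w ≠ 0 := fun h => hne1 (by rw [h, mul_zero])
      have hn2 : s.eval a * v - w ≠ 0 := fun h => hne2 (by linear_combination 2 * v * h)
      rw [e1, e2]
      rw [e1, e2] at of_nhds
      rcases lt_trichotomy (r.eval a) 0 with hr0 | hr0 | hr0
      · have hs0 : s.eval a ≠ 0 := by
          intro h
          rw [hrv, h] at hr0
          nlinarith [sq_nonneg w]
        have hneg : ∀ᶠ z in 𝓝 a, z ≠ a → (cubicResultant P Q).eval z < 0 := by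
          filter_upwards [eventually_eval_neg hr0] with z hz hza
          have : 0 < (z - a) ^ 2 := by
            have := sub_ne_zero.2 hza
            positivity
          rw [hr]
          simpa using mul_neg_of_pos_of_neg this hz
        refine ⟨-SignType.sign (s.eval a), SignType.sign (s.eval a), ?_, ?_, ?_⟩
        · filter_upwards [nhdsWithin_le_nhds hneg,
            nhdsWithin_le_nhds (eventually_sign_eval hs0), self_mem_nhdsWithin] with z h1 h2 hz
          have hz : z < a := hz
          rw [cubicStep, if_pos (h1 hz.ne), hs]
          simp [sign_mul, h2, sign_neg (sub_neg.2 hz)]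
        · filter_upwards [nhdsWithin_le_nhds hneg,
            nhdsWithin_le_nhds (eventually_sign_eval hs0), self_mem_nhdsWithin] with z h1 h2 hz
          have hz : a < z := hz
          rw [cubicStep, if_pos (h1 hz.ne'), hs]
          simp [sign_mul, h2, sign_pos (sub_pos.2 hz)]
        · have hpp : 0 < (s.eval a * v + w) * (s.eval a * v - w) := by linarith
          rcases hs0.lt_or_gt with h | h
          · have h' := mul_neg_of_neg_of_pos h hv0
            have h1 : s.eval a * v + w < 0 := by
              by_contra! hc
              nlinarith [lt_of_le_of_ne hc hn1.symm]
            have h2 : s.eval a * v - w < 0 := by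
              by_contra! hc
              nlinarith [lt_of_le_of_ne hc hn2.symm]
            simp [sign_neg h, sign_neg h1, sign_neg h2]
          · have h' := mul_pos h hv0
            have h1 : 0 < s.eval a * v + w := by
              by_contra! hc
              nlinarith [lt_of_le_of_ne hc hn1]
            have h2 : 0 < s.eval a * v - w := by
              by_contra! hc
              nlinarith [lt_of_le_of_ne hc hn2]
            simp [sign_pos h, sign_pos h1, sign_pos h2]
      · rw [hrv] at hr0
        exact absurd hr0 (neg_ne_zero.2 (mul_ne_zero hn1 hn2))
      · refine of_nhds 0 ?_ ?_
        · filter_upwards [eventually_eval_pos hr0] with z hz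
          refine if_neg (not_lt.2 ?_)
          rw [hr]
          simp only [eval_mul, eval_pow, eval_sub, eval_X, eval_C]
          positivity
        · rw [hrv] at hr0
          rcases mul_neg_iff.1 (neg_pos.1 hr0) with ⟨h1, h2⟩ | ⟨h1, h2⟩ <;>
            simp [sign_neg, sign_pos, h1, h2]
    · have hfib := critFiber_eq_singleton hR hP'
      set u := -(derivative Q).eval a / (derivative P).eval a
      have hu : u ∈ critFiber P Q a := by simp [hfib]
      have hH := hnd u hu
      have hd := derivative_cubicResultant_eval hu
      rw [hfib, Finset.sum_singleton]
      obtain ⟨r, hr, hra⟩ := exists_eq_X_sub_C_mul hR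
      rw [hd] at hra
      have hsgn := eventually_sign_eval hP'
      have hev : ∀ z, (cubicResultant P Q).eval z = (z - a) * r.eval z := by
        intro z
        rw [hr]
        simp
      have hr0 : r.eval a ≠ 0 := by
        rw [hra]
        exact mul_ne_zero (neg_ne_zero.2 hP') hH
      have hsH : SignType.sign (cubicHess P Q u a) =
          -SignType.sign (r.eval a) * SignType.sign ((derivative P).eval a) := by
        rw [hra, ← Left.sign_neg, ← sign_mul, show -(-(derivative P).eval a * cubicHess P Q u a) *
          (derivative P).eval a = (derivative P).eval a ^ 2 * cubicHess P Q u a by ring, sign_mul,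
          sign_pos (by positivity : 0 < (derivative P).eval a ^ 2), one_mul]
      rw [hsH]
      rcases hr0.lt_or_gt with h | h
      · refine ⟨0, SignType.sign ((derivative P).eval a), ?_, ?_, by simp [sign_neg h]⟩
        · filter_upwards [nhdsWithin_le_nhds (eventually_eval_neg h), self_mem_nhdsWithin]
            with z h1 hz
          refine if_neg (not_lt.2 ?_)
          rw [hev]
          exact (mul_pos_of_neg_of_neg (sub_neg.2 hz) h1).le
        · filter_upwards [nhdsWithin_le_nhds (eventually_eval_neg h), nhdsWithin_le_nhds hsgn,
            self_mem_nhdsWithin] with z h1 h2 hz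
          rw [cubicStep, if_pos, h2]
          rw [hev]
          exact mul_neg_of_pos_of_neg (sub_pos.2 hz) h1
      · refine ⟨SignType.sign ((derivative P).eval a), 0, ?_, ?_, by simp [sign_pos h]⟩
        · filter_upwards [nhdsWithin_le_nhds (eventually_eval_pos h), nhdsWithin_le_nhds hsgn,
            self_mem_nhdsWithin] with z h1 h2 hz
          rw [cubicStep, if_pos, h2]
          rw [hev]
          exact mul_neg_of_neg_of_pos (sub_neg.2 hz) h1
        · filter_upwards [nhdsWithin_le_nhds (eventually_eval_pos h), self_mem_nhdsWithin]
            with z h1 hz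
          refine if_neg (not_lt.2 ?_)
          rw [hev]
          exact (mul_pos (sub_pos.2 hz) h1).le
  · refine of_nhds 0 ?_ (by simp [critFiber_eq_empty hR.ne'])
    filter_upwards [eventually_eval_pos hR] with z hz
    exact if_neg hz.not_gt

/-- The critical points of `fiberedCubic b P Q`. -/
noncomputable def critFinset (b P Q : ℝ[X]) : Finset (ℝ × ℝ) :=
  ((cubicResultant P Q).roots.toFinset.sigma (critFiber P Q)).image
    fun s => (s.2 + b.eval s.1, s.1)

theorem mem_critFinset {b P Q : ℝ[X]} (hR : cubicResultant P Q ≠ 0) {p : ℝ × ℝ} :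
    p ∈ critFinset b P Q ↔ IsCriticalPt (fiberedCubic b P Q) p := by
  rw [isCriticalPt_fiberedCubic]
  simp only [critFinset, Finset.mem_image, Finset.mem_sigma, Multiset.mem_toFinset, mem_roots hR,
    IsRoot.def]
  constructor
  · rintro ⟨s, ⟨-, hs⟩, rfl⟩
    simpa using hs
  · intro h
    refine ⟨⟨p.2, p.1 - b.eval p.2⟩, ⟨?_, h⟩, by simp⟩
    by_contra h0
    simp [critFiber_eq_empty h0] at h

theorem sum_critFinset (b P Q : ℝ[X]) (φ : ℝ → ℝ → ℤ) :
    ∑ p ∈ critFinset b P Q, φ (p.1 - b.eval p.2) p.2 =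
      ∑ y ∈ (cubicResultant P Q).roots.toFinset, ∑ u ∈ critFiber P Q y, φ u y := by
  rw [critFinset, Finset.sum_image, Finset.sum_sigma]
  · simp
  · rintro ⟨y, u⟩ - ⟨y', u'⟩ - h
    simp only [Prod.mk.injEq] at h
    obtain ⟨h1, rfl⟩ := h
    simpa using h1

theorem Polynomial.eventually_atTop_eval_pos {p : ℝ[X]} (h : 0 < p.leadingCoeff) :
    ∀ᶠ y in atTop, 0 < p.eval y := by
  rcases Nat.eq_zero_or_pos p.natDegree with h0 | h0
  · rw [eq_C_of_natDegree_eq_zero h0] at h ⊢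
    exact Eventually.of_forall fun y => by simpa using h
  · exact (p.tendsto_atTop_of_leadingCoeff_nonneg (natDegree_pos_iff_degree_pos.1 h0)
      h.le).eventually_gt_atTop 0

theorem Polynomial.eventually_atBot_eval_pos {p : ℝ[X]} (h : 0 < p.leadingCoeff)
    (he : Even p.natDegree) : ∀ᶠ y in atBot, 0 < p.eval y := by
  have h1 : 0 < (p.comp (-X)).leadingCoeff := by
    rw [leadingCoeff_comp (by simp)]
    simpa [he.neg_one_pow] using h
  filter_upwards [tendsto_neg_atBot_atTop.eventually (eventually_atTop_eval_pos h1)] with y hy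
  simpa using hy

theorem fiberedCubic_euler_number {b P Q : ℝ[X]} (hlead : 0 < (cubicResultant P Q).leadingCoeff)
    (heven : Even (cubicResultant P Q).natDegree)
    (hnd : ∀ p, IsCriticalPt (fiberedCubic b P Q) p → hessDet (fiberedCubic b P Q) p ≠ 0) :
    {p | IsCriticalPt (fiberedCubic b P Q) p}.Finite ∧
    {p | IsCriticalPt (fiberedCubic b P Q) p}.ncard ≤ (cubicResultant P Q).natDegree ∧
    ({p | IsCriticalPt (fiberedCubic b P Q) p ∧ IsLocMin (fiberedCubic b P Q) p}.ncard : ℤ) -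
      ({p | IsSaddle (fiberedCubic b P Q) p}.ncard : ℤ) +
      ({p | IsCriticalPt (fiberedCubic b P Q) p ∧ IsLocMax (fiberedCubic b P Q) p}.ncard : ℤ)
      = 0 := by
  classical
  have hR : cubicResultant P Q ≠ 0 := leadingCoeff_ne_zero.1 hlead.ne'
  have hnd' : ∀ y, ∀ u ∈ critFiber P Q y, cubicHess P Q u y ≠ 0 := by
    intro y u hu
    have hp : IsCriticalPt (fiberedCubic b P Q) (u + b.eval y, y) :=
      isCriticalPt_fiberedCubic.2 (by simpa using hu)
    have := hnd _ hp
    rw [hessDet_fiberedCubic hp] at this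
    simpa using this
  set T := critFinset b P Q with hT
  have hset : {p | IsCriticalPt (fiberedCubic b P Q) p} = (T : Set (ℝ × ℝ)) :=
    Set.ext fun p => (mem_critFinset hR).symm
  have hfilter : ∀ S : ℝ × ℝ → Prop,
      ({p | IsCriticalPt (fiberedCubic b P Q) p ∧ S p}.ncard : ℤ) =
        ∑ p ∈ T, if S p then 1 else 0 := by
    intro S
    have : {p | IsCriticalPt (fiberedCubic b P Q) p ∧ S p} =
        ((T.filter S : Finset (ℝ × ℝ)) : Set (ℝ × ℝ)) := by
      ext p
      simp [hT, mem_critFinset hR]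
    rw [this, Set.ncard_coe_finset, Finset.sum_boole]
  refine ⟨hset ▸ T.finite_toSet, ?_, ?_⟩
  · rw [hset, Set.ncard_coe_finset]
    have h1 := sum_critFinset b P Q fun _ _ => 1
    simp only [Finset.sum_const, nsmul_eq_mul, mul_one] at h1
    have h2 : T.card = ∑ y ∈ (cubicResultant P Q).roots.toFinset, (critFiber P Q y).card := by
      exact_mod_cast h1
    rw [h2]
    calc _ ≤ ∑ y ∈ (cubicResultant P Q).roots.toFinset, (cubicResultant P Q).roots.count y :=
          Finset.sum_le_sum fun y _ => card_critFiber_le hR (hnd' y)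
      _ = (cubicResultant P Q).roots.card := Multiset.toFinset_sum_count_eq _
      _ ≤ _ := card_roots' _
  · have hsum : ∑ p ∈ T, (SignType.sign (cubicHess P Q (p.1 - b.eval p.2) p.2) : ℤ) = 0 := by
      rw [sum_critFinset b P Q fun u y => (SignType.sign (cubicHess P Q u y) : ℤ)]
      refine sum_jump_eq_zero (cubicStep P Q)
        (fun y => ∑ u ∈ critFiber P Q y, (SignType.sign (cubicHess P Q u y) : ℤ)) _ ?_
        (fun y => jump_cubicStep (hnd' y)) ?_ ?_
      · intro y hy
        rw [Multiset.mem_toFinset, mem_roots hR] at hy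
        simp [critFiber_eq_empty hy]
      · filter_upwards [eventually_atTop_eval_pos hlead] with z hz
        exact if_neg hz.not_gt
      · filter_upwards [eventually_atBot_eval_pos hlead heven] with z hz
        exact if_neg hz.not_gt
    have hsad : {p | IsSaddle (fiberedCubic b P Q) p} = {p | IsCriticalPt (fiberedCubic b P Q) p ∧
        (¬ IsLocMin (fiberedCubic b P Q) p ∧ ¬ IsLocMax (fiberedCubic b P Q) p)} := rfl
    rw [hsad, hfilter, hfilter, hfilter, ← Finset.sum_sub_distrib, ← Finset.sum_add_distrib]
    refine (Finset.sum_congr rfl fun p hp => ?_).trans hsum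
    have hp := (mem_critFinset hR).1 hp
    have hne := hnd p hp
    rw [hessDet_fiberedCubic hp] at hne
    rcases hne.lt_or_gt with h | h
    · obtain ⟨-, h1, h2⟩ := isSaddle_of_cubicHess_neg hp h
      simp [h1, h2, sign_neg h]
    · rcases isLocMin_xor_isLocMax hp h with ⟨h1, h2⟩ | ⟨h1, h2⟩ <;> simp [h1, h2, sign_pos h]

theorem natDegree_cubicResultant_le {P Q : ℝ[X]} (hP : P.natDegree ≤ 4) (hQ : Q.natDegree ≤ 6) :
    (cubicResultant P Q).natDegree ≤ 10 := by
  have hP' : (derivative P).natDegree ≤ 3 := (natDegree_derivative_le P).trans (by omega)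
  have hQ' : (derivative Q).natDegree ≤ 5 := (natDegree_derivative_le Q).trans (by omega)
  exact natDegree_add_le_of_degree_le (natDegree_pow_le_of_le 2 hQ')
    (natDegree_mul_le_of_le hP (natDegree_pow_le_of_le 2 hP'))

theorem coeff_cubicResultant {P Q : ℝ[X]} (hP : P.natDegree ≤ 4) (hQ : Q.natDegree ≤ 6) :
    (cubicResultant P Q).coeff 10 = 36 * Q.coeff 6 ^ 2 + 16 * P.coeff 4 ^ 3 := by
  have hP' : (derivative P).natDegree ≤ 3 := (natDegree_derivative_le P).trans (by omega)
  have hQ' : (derivative Q).natDegree ≤ 5 := (natDegree_derivative_le Q).trans (by omega)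
  have h1 := coeff_pow_of_natDegree_le (m := 2) hQ'
  have h2 := coeff_pow_of_natDegree_le (m := 2) hP'
  have h3 := coeff_mul_add_eq_of_natDegree_le hP (natDegree_pow_le_of_le 2 hP')
  norm_num at h1 h2 h3
  rw [cubicResultant, coeff_add, h1, h3, h2, coeff_derivative, coeff_derivative]
  norm_num
  ring

theorem exists_J1vers_eq_fiberedCubic (γ l1 l2 l3 l4 l5 l6 l7 l8 l9 : ℝ) :
    ∃ b P Q : ℝ[X], J1vers γ l1 l2 l3 l4 l5 l6 l7 l8 l9 = fiberedCubic b P Q ∧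
      P.natDegree ≤ 4 ∧ Q.natDegree ≤ 6 ∧ P.coeff 4 = 1 / 3 - γ ^ 2 / 9 ∧
      Q.coeff 6 = -(2 * γ / 9 + 2 * γ ^ 3 / 81) := by
  refine ⟨C (γ / 3) * X ^ 2 + C (-l9) * X,
    C (1 / 3 - γ ^ 2 / 9) * X ^ 4 + C (2 * γ * l9 / 3) * X ^ 3 + C (l8 - l9 ^ 2) * X ^ 2 +
      C l7 * X + C l6,
    C (-(2 * γ / 9 + 2 * γ ^ 3 / 81)) * X ^ 6 + C (3 * l9 - l9 / 3 + 2 * γ ^ 2 * l9 / 9) * X ^ 5 +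
      C (l5 + γ * l8 / 3 - 2 * γ * l9 ^ 2 / 3) * X ^ 4 +
      C (l4 + γ * l7 / 3 - l8 * l9 + 2 * l9 ^ 3 / 3) * X ^ 3 +
      C (l3 + γ * l6 / 3 - l7 * l9) * X ^ 2 + C (l2 - l6 * l9) * X + C l1, ?_, ?_, ?_, ?_, ?_⟩
  · funext x y
    simp [J1vers, fiberedCubic]
    ring
  · compute_degree
  · compute_degree
  · simp only [coeff_add, coeff_C_mul, coeff_X, coeff_C]
    norm_num
  · simp only [coeff_add, coeff_C_mul, coeff_X, coeff_C]
    norm_num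

/-- A Morse polynomial of the canonical versal deformation of `J₁₀¹` has a finite set
of critical points, at most ten of them, its Euler number `m₋ − m× + m₊` equals `0`,
and the total number of real critical points is even. -/
theorem J1vers_euler_number (γ l1 l2 l3 l4 l5 l6 l7 l8 l9 : ℝ)
    (hnd : ∀ p : ℝ × ℝ, IsCriticalPt (J1vers γ l1 l2 l3 l4 l5 l6 l7 l8 l9) p →
      hessDet (J1vers γ l1 l2 l3 l4 l5 l6 l7 l8 l9) p ≠ 0) :
    {p : ℝ × ℝ | IsCriticalPt (J1vers γ l1 l2 l3 l4 l5 l6 l7 l8 l9) p}.Finite ∧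
    {p : ℝ × ℝ | IsCriticalPt (J1vers γ l1 l2 l3 l4 l5 l6 l7 l8 l9) p}.ncard ≤ 10 ∧
    ({p : ℝ × ℝ | IsCriticalPt (J1vers γ l1 l2 l3 l4 l5 l6 l7 l8 l9) p ∧
        IsLocMin (J1vers γ l1 l2 l3 l4 l5 l6 l7 l8 l9) p}.ncard : ℤ) -
      ({p : ℝ × ℝ | IsSaddle (J1vers γ l1 l2 l3 l4 l5 l6 l7 l8 l9) p}.ncard : ℤ) +
      ({p : ℝ × ℝ | IsCriticalPt (J1vers γ l1 l2 l3 l4 l5 l6 l7 l8 l9) p ∧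
        IsLocMax (J1vers γ l1 l2 l3 l4 l5 l6 l7 l8 l9) p}.ncard : ℤ) = 0 ∧
    Even ({p : ℝ × ℝ | IsCriticalPt (J1vers γ l1 l2 l3 l4 l5 l6 l7 l8 l9) p ∧
        IsLocMin (J1vers γ l1 l2 l3 l4 l5 l6 l7 l8 l9) p}.ncard +
      {p : ℝ × ℝ | IsSaddle (J1vers γ l1 l2 l3 l4 l5 l6 l7 l8 l9) p}.ncard +
      {p : ℝ × ℝ | IsCriticalPt (J1vers γ l1 l2 l3 l4 l5 l6 l7 l8 l9) p ∧
        IsLocMax (J1vers γ l1 l2 l3 l4 l5 l6 l7 l8 l9) p}.ncard) := by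
  obtain ⟨b, P, Q, hf, hP, hQ, hp, hq⟩ :=
    exists_J1vers_eq_fiberedCubic γ l1 l2 l3 l4 l5 l6 l7 l8 l9
  rw [hf] at hnd ⊢
  have hdeg := natDegree_cubicResultant_le hP hQ
  have hcoeff : 0 < (cubicResultant P Q).coeff 10 := by
    rw [coeff_cubicResultant hP hQ, hp, hq]
    have : (36 * (-(2 * γ / 9 + 2 * γ ^ 3 / 81)) ^ 2 + 16 * (1 / 3 - γ ^ 2 / 9) ^ 3 : ℝ) =
        16 / 27 * (1 + γ ^ 2) ^ 2 := by ring
    rw [this]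
    positivity
  have hdeg' : (cubicResultant P Q).natDegree = 10 :=
    natDegree_eq_of_le_of_coeff_ne_zero hdeg hcoeff.ne'
  obtain ⟨h1, h2, h3⟩ := fiberedCubic_euler_number (b := b) (P := P) (Q := Q)
    (by rwa [leadingCoeff, hdeg']) (by rw [hdeg']; decide) hnd
  refine ⟨h1, h2.trans hdeg, h3, ?_⟩
  rw [← Int.even_coe_nat]
  refine ⟨({p | IsSaddle (fiberedCubic b P Q) p}.ncard : ℤ), ?_⟩
  push_cast
  linarith
end

section
/- Let γ ∈ (−1, 1) and λ₁, …, λ₉ be real numbers and f(x,y) = (1/3)(x − γy²)(x² − y⁴) + λ₁ + λ₂y + λ₃y² + λ₄y³ + λ₅y⁴ + λ₆x + λ₇xy + λ₈xy² + λ₉(x² − 3y⁴)y. Suppose every critical point of f is nondegenerate. Then the set of critical points of f is finite and has at most 10 elements; moreover, if m₋, m×, m₊ denote the numbers of local minima, saddles, and local maxima of f respectively, then m₋ − m× + m₊ = −2; in particular the total number m₋ + m× + m₊ of real critical points is even. -/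
/-- The canonical versal deformation of the real singularity class `J₁₀³`. -/
noncomputable def J3vers (γ l1 l2 l3 l4 l5 l6 l7 l8 l9 : ℝ) : ℝ → ℝ → ℝ := fun x y =>
  (1 / 3) * (x - γ * y ^ 2) * (x ^ 2 - y ^ 4) + l1 + l2 * y + l3 * y ^ 2 + l4 * y ^ 3 +
      l5 * y ^ 4 + l6 * x + l7 * x * y + l8 * x * y ^ 2 + l9 * (x ^ 2 - 3 * y ^ 4) * y

open Filter Topology Polynomial

/-- A function with one-sided limits everywhere and finitely many jumps has total variation of
values equal to the sum of its jumps. -/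
theorem sum_jumps_eq_sub {φ j : ℝ → ℤ} {S : Finset ℝ} {L M : ℤ}
    (hj : ∀ y ∉ S, j y = 0)
    (h : ∀ y, ∃ a, (∀ᶠ t in 𝓝[<] y, φ t = a) ∧ ∀ᶠ t in 𝓝[>] y, φ t = a + j y)
    (hbot : ∀ᶠ t in atBot, φ t = L) (htop : ∀ᶠ t in atTop, φ t = M) :
    ∑ s ∈ S, j s = M - L := by
  classical
  set ψ : ℝ → ℤ := fun t => φ t - ∑ s ∈ S with s < t, j s with hψ
  have hψc : ∀ y, ∃ c, ∀ᶠ t in 𝓝[≠] y, ψ t = c := fun y => by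
    obtain ⟨a, hl, hr⟩ := h y
    have hnear : ∀ᶠ t in 𝓝 y, ∀ s ∈ S, s ≠ y → (s < t ↔ s < y) := by
      rw [Filter.eventually_all_finset]
      intro s _
      rcases lt_trichotomy s y with hs | hs | hs
      · filter_upwards [lt_mem_nhds hs] with t ht _
        simp [ht, hs]
      · exact .of_forall fun t hne => absurd hs hne
      · filter_upwards [gt_mem_nhds hs] with t ht _
        simp [ht.not_gt, hs.not_gt]
    refine ⟨a - ∑ s ∈ S with s < y, j s, ?_⟩
    rw [punctured_nhds_eq_nhdsWithin_sup_nhdsWithin, eventually_sup]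
    constructor
    · filter_upwards [hl, mem_nhdsWithin_of_mem_nhds hnear, self_mem_nhdsWithin] with t ht hn hty
      have : S.filter (· < t) = S.filter (· < y) := by
        refine Finset.filter_congr fun s hs => ?_
        by_cases hsy : s = y
        · simp [hsy, (Set.mem_Iio.1 hty).le]
        · exact hn s hs hsy
      simp only [hψ, ht, this]
    · filter_upwards [hr, mem_nhdsWithin_of_mem_nhds hnear, self_mem_nhdsWithin] with t ht hn hty
      have hty : y < t := hty
      have : ∑ s ∈ S with s < t, j s = ∑ s ∈ S with s < y, j s + j y := by
        by_cases hy : y ∈ S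
        · have : S.filter (· < t) = insert y (S.filter (· < y)) := by
            ext s
            by_cases hsy : s = y
            · simp [hsy, hy, hty]
            · simp only [Finset.mem_filter, Finset.mem_insert, hsy, false_or]
              exact and_congr_right fun hs => hn s hs hsy
          rw [this, Finset.sum_insert (by simp), add_comm]
        · rw [hj y hy, add_zero]
          congr 1
          exact Finset.filter_congr fun s hs => hn s hs (fun hsy => hy (hsy ▸ hs))
      simp only [hψ, ht, this]
      ring
  choose c hc using hψc
  have hlc : IsLocallyConstant c := by
    rw [IsLocallyConstant.iff_eventually_eq]
    intro y
    have h1 := hc y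
    rw [eventually_nhdsWithin_iff] at h1
    filter_upwards [eventually_eventually_nhds.2 h1] with z hz
    by_cases hzy : z = y
    · rw [hzy]
    · have h2 : ∀ᶠ t in 𝓝[≠] z, ψ t = c y := by
        filter_upwards [mem_nhdsWithin_of_mem_nhds hz,
          mem_nhdsWithin_of_mem_nhds (isOpen_ne.mem_nhds hzy)] with t ht hty using ht hty
      obtain ⟨t, ht1, ht2⟩ := ((hc z).and h2).exists
      exact ht1.symm.trans ht2
  have hL : c (0 : ℝ) = L := by
    have hsmall : ∀ᶠ t in atBot, ∀ s ∈ S, t ≤ s :=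
      (Filter.eventually_all_finset S).2 fun s _ => eventually_le_atBot s
    obtain ⟨a, ha⟩ := eventually_atBot.1 (hbot.and hsmall)
    obtain ⟨t, ht, hta⟩ := ((hc (a - 1)).and
      (mem_nhdsWithin_of_mem_nhds (Iio_mem_nhds (sub_one_lt a)))).exists
    obtain ⟨h1, h2⟩ := ha t (le_of_lt hta)
    rw [hlc.apply_eq_of_preconnectedSpace 0 (a - 1), ← ht]
    simp only [hψ, h1]
    rw [Finset.filter_false_of_mem fun s hs => (h2 s hs).not_gt]
    simp
  have hM : c (0 : ℝ) = M - ∑ s ∈ S, j s := by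
    have hlarge : ∀ᶠ t in atTop, ∀ s ∈ S, s < t :=
      (Filter.eventually_all_finset S).2 fun s _ => eventually_gt_atTop s
    obtain ⟨a, ha⟩ := eventually_atTop.1 (htop.and hlarge)
    obtain ⟨t, ht, hta⟩ := ((hc (a + 1)).and
      (mem_nhdsWithin_of_mem_nhds (Ioi_mem_nhds (lt_add_one a)))).exists
    obtain ⟨h1, h2⟩ := ha t (le_of_lt hta)
    rw [hlc.apply_eq_of_preconnectedSpace 0 (a + 1), ← ht]
    simp only [hψ, h1]
    rw [Finset.filter_true_of_mem h2]
  linarith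

/-- The sign `a` where `r = -1`, and `0` elsewhere. -/
def signJump (r a : SignType) : ℤ := if r = -1 then (a : ℤ) else 0

theorem eventually_sign_eval_eq {P : ℝ[X]} {y : ℝ} (h : P.eval y ≠ 0) :
    ∀ᶠ t in 𝓝 y, SignType.sign (P.eval t) = SignType.sign (P.eval y) := by
  have := (continuousAt_sign_of_ne_zero h).comp (f := fun t => P.eval t) P.continuous.continuousAt
  simpa using this.eventually_mem ((isOpen_discrete {SignType.sign (P.eval y)}).mem_nhds rfl)

theorem eventually_sign_eq_of_isEquivalent {l : Filter ℝ} {u v : ℝ → ℝ}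
    (h : Asymptotics.IsEquivalent l u v) :
    ∀ᶠ t in l, SignType.sign (u t) = SignType.sign (v t) := by
  obtain ⟨w, hw, huv⟩ := h.exists_eq_mul
  filter_upwards [huv, hw.eventually (lt_mem_nhds one_pos)] with t ht hpos
  rw [ht, Pi.mul_apply, sign_mul, sign_pos hpos, one_mul]

theorem eventually_atTop_sign_eval (P : ℝ[X]) :
    ∀ᶠ t in atTop, SignType.sign (P.eval t) = SignType.sign P.leadingCoeff := by
  filter_upwards [eventually_sign_eq_of_isEquivalent P.isEquivalent_atTop_lead,
    eventually_gt_atTop 0] with t ht hpos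
  rw [ht, sign_mul, sign_pos (pow_pos hpos _), mul_one]

theorem eventually_atBot_sign_eval (P : ℝ[X]) :
    ∀ᶠ t in atBot, SignType.sign (P.eval t) =
      SignType.sign P.leadingCoeff * (-1) ^ P.natDegree := by
  filter_upwards [eventually_sign_eq_of_isEquivalent P.isEquivalent_atBot_lead,
    eventually_lt_atBot 0] with t ht hneg
  rw [ht, sign_mul, sign_pow, sign_neg hneg]

/-- The resultant, with respect to `x`, of `x² + p x + q` and `A x + B`. -/
noncomputable def linearResultant (p q A B : ℝ[X]) : ℝ[X] := B ^ 2 - p * A * B + q * A ^ 2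

/-- The Jacobian determinant of the map `(x, y) ↦ (x² + p(y) x + q(y), A(y) x + B(y))`. -/
noncomputable def linearJacobian (p q A B : ℝ[X]) (x y : ℝ) : ℝ :=
  (2 * x + p.eval y) * (A.derivative.eval y * x + B.derivative.eval y) -
    (p.derivative.eval y * x + q.derivative.eval y) * A.eval y

/-- `sign A` where the resultant is negative, and `0` elsewhere. -/
noncomputable def jumpFunction (p q A B : ℝ[X]) (y : ℝ) : ℤ :=
  signJump (SignType.sign ((linearResultant p q A B).eval y)) (SignType.sign (A.eval y))

section Fibre

variable {p q A B : ℝ[X]} {y : ℝ}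

theorem fibre_of_resultant_ne_zero (hR : (linearResultant p q A B).eval y ≠ 0) :
    (∀ x, ¬ (x ^ 2 + p.eval y * x + q.eval y = 0 ∧ A.eval y * x + B.eval y = 0)) ∧
    ∀ᶠ t in 𝓝 y, jumpFunction p q A B t = jumpFunction p q A B y := by
  constructor
  · rintro x ⟨h1, h2⟩
    apply hR
    simp only [linearResultant, eval_add, eval_sub, eval_mul, eval_pow]
    linear_combination (B.eval y - p.eval y * A.eval y - A.eval y * x) * h2 + A.eval y ^ 2 * h1
  · by_cases hA : A.eval y = 0
    · have hpos : 0 < (linearResultant p q A B).eval y := by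
        refine lt_of_le_of_ne ?_ hR.symm
        simp [linearResultant, hA, sq_nonneg]
      filter_upwards [eventually_sign_eval_eq hR] with t ht
      simp [jumpFunction, ht, sign_pos hpos, signJump]
    · filter_upwards [eventually_sign_eval_eq hR, eventually_sign_eval_eq hA] with t ht hAt
      simp [jumpFunction, ht, hAt]

theorem fibre_of_eval_ne_zero (hR : (linearResultant p q A B).eval y = 0) (hA : A.eval y ≠ 0)
    (hJ : ∀ x, x ^ 2 + p.eval y * x + q.eval y = 0 ∧ A.eval y * x + B.eval y = 0 →
      linearJacobian p q A B x y ≠ 0) :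
    ∃ x₀, (∀ x, x = x₀ ↔ x ^ 2 + p.eval y * x + q.eval y = 0 ∧ A.eval y * x + B.eval y = 0) ∧
    ∃ a, (∀ᶠ t in 𝓝[<] y, jumpFunction p q A B t = a) ∧
      ∀ᶠ t in 𝓝[>] y, jumpFunction p q A B t =
        a + (SignType.sign (linearJacobian p q A B x₀ y) : ℤ) := by
  set x₀ := -B.eval y / A.eval y with hx₀
  have h2 : A.eval y * x₀ + B.eval y = 0 := by rw [hx₀]; field_simp; ring
  have h1 : x₀ ^ 2 + p.eval y * x₀ + q.eval y = 0 := by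
    have : A.eval y ^ 2 * (x₀ ^ 2 + p.eval y * x₀ + q.eval y) = 0 := by
      rw [← hR]
      simp only [linearResultant, eval_add, eval_sub, eval_mul, eval_pow]
      linear_combination -(B.eval y - p.eval y * A.eval y - A.eval y * x₀) * h2
    simpa [hA] using this
  obtain ⟨R₁, hR₁⟩ := dvd_iff_isRoot.2 hR
  have hRJ : R₁.eval y = -(A.eval y * linearJacobian p q A B x₀ y) := by
    have hd := congrArg (fun P : ℝ[X] => P.derivative.eval y) hR₁
    simp [linearResultant, derivative_pow] at hd
    rw [← hd, linearJacobian]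
    have hB : B.eval y = -(A.eval y * x₀) := by linarith
    rw [hB]
    linear_combination 2 * A.eval y * A.derivative.eval y * h1
  have hJ0 := hJ x₀ ⟨h1, h2⟩
  have hR₁0 : R₁.eval y ≠ 0 := by rw [hRJ]; exact neg_ne_zero.2 (mul_ne_zero hA hJ0)
  refine ⟨x₀, fun x => ⟨fun h => h ▸ ⟨h1, h2⟩, fun h => mul_left_cancel₀ hA (by linarith [h.2])⟩, ?_⟩
  have hs : SignType.sign (R₁.eval y) =
      -(SignType.sign (A.eval y) * SignType.sign (linearJacobian p q A B x₀ y)) := by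
    rw [hRJ, Left.sign_neg, sign_mul]
  have hev := (eventually_sign_eval_eq hR₁0).and (eventually_sign_eval_eq hA)
  refine ⟨signJump (-SignType.sign (R₁.eval y)) (SignType.sign (A.eval y)), ?_, ?_⟩
  · filter_upwards [mem_nhdsWithin_of_mem_nhds hev, self_mem_nhdsWithin] with t ⟨ht1, ht2⟩ hty
    have : t - y < 0 := sub_neg.2 hty
    simp [jumpFunction, hR₁, sign_mul, ht1, ht2, sign_neg this]
  · filter_upwards [mem_nhdsWithin_of_mem_nhds hev, self_mem_nhdsWithin] with t ⟨ht1, ht2⟩ hty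
    have : 0 < t - y := sub_pos.2 hty
    simp only [jumpFunction, hR₁, eval_mul, eval_sub, eval_X, eval_C, sign_mul, ht1, ht2,
      sign_pos this, one_mul]
    have hA' := sign_ne_zero.2 hA
    have hJ' := sign_ne_zero.2 hJ0
    rw [hs]
    generalize SignType.sign (A.eval y) = a at *
    generalize SignType.sign (linearJacobian p q A B x₀ y) = b at *
    clear hs hev ht1 ht2
    revert a b
    decide

theorem fibre_of_eval_eq_zero (hA : A.eval y = 0) (hB : B.eval y = 0)
    (hJ : ∀ x, x ^ 2 + p.eval y * x + q.eval y = 0 ∧ A.eval y * x + B.eval y = 0 →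
      linearJacobian p q A B x y ≠ 0) :
    ∃ T : Finset ℝ,
    (∀ x, x ∈ T ↔ x ^ 2 + p.eval y * x + q.eval y = 0 ∧ A.eval y * x + B.eval y = 0) ∧
    T.card ≤ 2 ∧
    ∃ a, (∀ᶠ t in 𝓝[<] y, jumpFunction p q A B t = a) ∧
      ∀ᶠ t in 𝓝[>] y, jumpFunction p q A B t =
        a + ∑ x ∈ T, (SignType.sign (linearJacobian p q A B x y) : ℤ) := by
  simp only [hA, hB, zero_mul, add_zero, and_true] at hJ ⊢
  rcases lt_or_ge (p.eval y ^ 2 - 4 * q.eval y) 0 with hD | hD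
  · refine ⟨∅, fun x => ?_, by simp, 0, ?_⟩
    · simp only [Finset.notMem_empty, false_iff]
      intro h
      nlinarith [sq_nonneg (2 * x + p.eval y)]
    · have hev : ∀ᶠ t in 𝓝 y, jumpFunction p q A B t = 0 := by
        have hc : Continuous fun t => p.eval t ^ 2 - 4 * q.eval t := by fun_prop
        filter_upwards [hc.continuousAt.eventually (gt_mem_nhds hD)] with t ht
        have : 0 ≤ (linearResultant p q A B).eval t := by
          simp only [linearResultant, eval_add, eval_sub, eval_mul, eval_pow]
          nlinarith [sq_nonneg (2 * B.eval t - p.eval t * A.eval t),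
            mul_nonneg (sq_nonneg (A.eval t)) (neg_nonneg.2 ht.le)]
        rw [jumpFunction, signJump, if_neg]
        rw [sign_eq_neg_one_iff]
        exact this.not_gt
      simpa using ⟨hev.filter_mono nhdsWithin_le_nhds, hev.filter_mono nhdsWithin_le_nhds⟩
  · obtain ⟨A₁, rfl⟩ := dvd_iff_isRoot.2 hA
    obtain ⟨B₁, rfl⟩ := dvd_iff_isRoot.2 hB
    set s := √(p.eval y ^ 2 - 4 * q.eval y) with hs
    have hs2 : s ^ 2 = p.eval y ^ 2 - 4 * q.eval y := Real.sq_sqrt hD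
    have hs0 : 0 ≤ s := Real.sqrt_nonneg _
    have hJac : ∀ x, linearJacobian p q ((X - C y) * A₁) ((X - C y) * B₁) x y =
        (2 * x + p.eval y) * (A₁.eval y * x + B₁.eval y) := by
      intro x; simp [linearJacobian]
    simp only [hJac] at hJ ⊢
    set x₁ := (-p.eval y + s) / 2 with hx₁
    set x₂ := (-p.eval y - s) / 2 with hx₂
    have hfac : ∀ x, x ^ 2 + p.eval y * x + q.eval y = (x - x₁) * (x - x₂) := by
      intro x; rw [hx₁, hx₂]; linear_combination hs2 / 4
    simp only [hfac, mul_eq_zero, sub_eq_zero] at hJ ⊢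
    have hJ1 := hJ x₁ (.inl rfl)
    have hJ2 := hJ x₂ (.inr rfl)
    have e1 : 2 * x₁ + p.eval y = s := by rw [hx₁]; ring
    have e2 : 2 * x₂ + p.eval y = -s := by rw [hx₂]; ring
    rw [e1] at hJ1
    rw [e2] at hJ2
    have hspos : 0 < s := lt_of_le_of_ne hs0 (left_ne_zero_of_mul hJ1).symm
    have hne : x₁ ≠ x₂ := by intro h; rw [h] at e1; linarith
    refine ⟨{x₁, x₂}, fun x => by simp, Finset.card_le_two, ?_⟩
    rw [Finset.sum_pair hne, e1, e2, sign_mul, sign_mul, Left.sign_neg, sign_pos hspos]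
    set a₁ := A₁.eval y * x₁ + B₁.eval y with ha₁
    set a₂ := A₁.eval y * x₂ + B₁.eval y with ha₂
    have hA₁ : A₁.eval y * s = a₁ - a₂ := by rw [ha₁, ha₂, hx₁, hx₂]; ring
    have hR : linearResultant p q ((X - C y) * A₁) ((X - C y) * B₁) =
        (X - C y) ^ 2 * linearResultant p q A₁ B₁ := by simp only [linearResultant]; ring
    have hRy : (linearResultant p q A₁ B₁).eval y = a₁ * a₂ := by
      simp only [linearResultant, eval_add, eval_sub, eval_mul, eval_pow]
      rw [ha₁, ha₂, hx₁, hx₂]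
      linear_combination A₁.eval y ^ 2 * hs2 / 4
    have h1 : a₁ ≠ 0 := right_ne_zero_of_mul hJ1
    have h2 : a₂ ≠ 0 := right_ne_zero_of_mul hJ2
    have hR0 : (linearResultant p q A₁ B₁).eval y ≠ 0 := hRy ▸ mul_ne_zero h1 h2
    have hjump : ∀ t, t ≠ y → jumpFunction p q ((X - C y) * A₁) ((X - C y) * B₁) t =
        signJump (SignType.sign ((linearResultant p q A₁ B₁).eval t))
          (SignType.sign (t - y) * SignType.sign (A₁.eval t)) := by
      intro t ht
      have : 0 < (t - y) ^ 2 := by have := sub_ne_zero.2 ht; positivity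
      simp only [jumpFunction, hR, eval_mul, eval_pow, eval_sub, eval_X, eval_C, sign_mul,
        sign_pos this, one_mul]
    rcases lt_or_gt_of_ne (hRy ▸ hR0) with hneg | hpos
    · have hs12 : SignType.sign a₂ = -SignType.sign a₁ := by
        rcases mul_neg_iff.1 hneg with ⟨h, h'⟩ | ⟨h, h'⟩ <;>
          simp [sign_pos, sign_neg, h, h']
      have hsA : SignType.sign (A₁.eval y) = SignType.sign a₁ := by
        have : SignType.sign (a₁ - a₂) = SignType.sign a₁ := by
          rcases mul_neg_iff.1 hneg with ⟨h, h'⟩ | ⟨h, h'⟩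
          · rw [sign_pos h, sign_pos (by linarith)]
          · rw [sign_neg h, sign_neg (by linarith)]
        rw [← this, ← hA₁, sign_mul, sign_pos hspos, mul_one]
      have hA0 : A₁.eval y ≠ 0 := by
        rw [← sign_ne_zero, hsA, sign_ne_zero]; exact h1
      have hev := (eventually_sign_eval_eq hR0).and (eventually_sign_eval_eq hA0)
      rw [hRy, sign_neg hneg, hsA] at hev
      refine ⟨-(SignType.sign a₁ : ℤ), ?_, ?_⟩
      · filter_upwards [mem_nhdsWithin_of_mem_nhds hev, self_mem_nhdsWithin] with t ⟨ht1, ht2⟩ hty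
        have : t - y < 0 := sub_neg.2 hty
        rw [hjump t (ne_of_lt hty), ht1, ht2, sign_neg this]
        simp [signJump]
      · filter_upwards [mem_nhdsWithin_of_mem_nhds hev, self_mem_nhdsWithin] with t ⟨ht1, ht2⟩ hty
        have : 0 < t - y := sub_pos.2 hty
        rw [hjump t (ne_of_gt hty), ht1, ht2, sign_pos this, hs12]
        simp [signJump]
    · have hs12 : SignType.sign a₂ = SignType.sign a₁ := by
        rcases mul_pos_iff.1 hpos with ⟨h, h'⟩ | ⟨h, h'⟩ <;>
          simp [sign_pos, sign_neg, h, h']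
      have hev : ∀ᶠ t in 𝓝[≠] y,
          jumpFunction p q ((X - C y) * A₁) ((X - C y) * B₁) t = 0 := by
        filter_upwards [mem_nhdsWithin_of_mem_nhds (eventually_sign_eval_eq hR0),
          self_mem_nhdsWithin] with t ht hty
        rw [hjump t hty, ht, hRy, sign_pos hpos]
        simp [signJump]
      rw [punctured_nhds_eq_nhdsWithin_sup_nhdsWithin, eventually_sup] at hev
      exact ⟨0, hev.1, by simpa [hs12] using hev.2⟩

end Fibre

theorem exists_finset_fibre {p q A B : ℝ[X]} (hR : linearResultant p q A B ≠ 0) (y : ℝ)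
    (hJ : ∀ x, x ^ 2 + p.eval y * x + q.eval y = 0 ∧ A.eval y * x + B.eval y = 0 →
      linearJacobian p q A B x y ≠ 0) :
    ∃ T : Finset ℝ,
    (∀ x, x ∈ T ↔ x ^ 2 + p.eval y * x + q.eval y = 0 ∧ A.eval y * x + B.eval y = 0) ∧
    T.card ≤ (linearResultant p q A B).roots.count y ∧
    ∃ a, (∀ᶠ t in 𝓝[<] y, jumpFunction p q A B t = a) ∧
      ∀ᶠ t in 𝓝[>] y, jumpFunction p q A B t =
        a + ∑ x ∈ T, (SignType.sign (linearJacobian p q A B x y) : ℤ) := by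
  rw [count_roots]
  by_cases hRy : (linearResultant p q A B).eval y = 0
  · by_cases hA : A.eval y = 0
    · have hB : B.eval y = 0 := by simpa [linearResultant, hA] using hRy
      obtain ⟨T, hT, hcard, h⟩ := fibre_of_eval_eq_zero hA hB hJ
      refine ⟨T, hT, hcard.trans ((le_rootMultiplicity_iff hR).2 ?_), h⟩
      obtain ⟨A₁, rfl⟩ := dvd_iff_isRoot.2 hA
      obtain ⟨B₁, rfl⟩ := dvd_iff_isRoot.2 hB
      exact ⟨linearResultant p q A₁ B₁, by simp only [linearResultant]; ring⟩
    · obtain ⟨x₀, hx₀, h⟩ := fibre_of_eval_ne_zero hRy hA hJ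
      refine ⟨{x₀}, by simpa using hx₀, ?_, by simpa using h⟩
      exact (Finset.card_singleton x₀).trans_le ((rootMultiplicity_pos hR).2 hRy)
  · obtain ⟨hno, hev⟩ := fibre_of_resultant_ne_zero hRy
    refine ⟨∅, by simpa using hno, by simp, _, hev.filter_mono nhdsWithin_le_nhds, ?_⟩
    simpa using hev.filter_mono nhdsWithin_le_nhds

/-- Signed and unsigned count of the solutions of `x² + p(y) x + q(y) = 0 = A(y) x + B(y)`. -/
theorem exists_finset_sum_sign_linearJacobian {p q A B : ℝ[X]} {L M : ℤ}
    (hR : linearResultant p q A B ≠ 0)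
    (hJ : ∀ x y, x ^ 2 + p.eval y * x + q.eval y = 0 ∧ A.eval y * x + B.eval y = 0 →
      linearJacobian p q A B x y ≠ 0)
    (hbot : ∀ᶠ t in atBot, jumpFunction p q A B t = L)
    (htop : ∀ᶠ t in atTop, jumpFunction p q A B t = M) :
    ∃ Z : Finset (ℝ × ℝ),
    (∀ z, z ∈ Z ↔ z.1 ^ 2 + p.eval z.2 * z.1 + q.eval z.2 = 0 ∧
      A.eval z.2 * z.1 + B.eval z.2 = 0) ∧
    Z.card ≤ (linearResultant p q A B).natDegree ∧
    ∑ z ∈ Z, (SignType.sign (linearJacobian p q A B z.1 z.2) : ℤ) = M - L := by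
  classical
  choose T hT hcard hjump using fun y => exists_finset_fibre hR y fun x => hJ x y
  set S := (linearResultant p q A B).roots.toFinset with hS
  have hTS : ∀ y ∉ S, T y = ∅ := fun y hy => by
    have := hcard y
    rw [Multiset.count_eq_zero.2 (by simpa [hS] using hy)] at this
    exact Finset.card_eq_zero.1 (Nat.le_zero.1 this)
  set Z : Finset (ℝ × ℝ) := (S.biUnion T ×ˢ S).filter fun z => z.1 ∈ T z.2 with hZ
  have hmem : ∀ z : ℝ × ℝ, z ∈ Z ↔ z.2 ∈ S ∧ z.1 ∈ T z.2 := fun z => by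
    simp only [hZ, Finset.mem_filter, Finset.mem_product, Finset.mem_biUnion]
    exact ⟨fun h => ⟨h.1.2, h.2⟩, fun h => ⟨⟨⟨z.2, h.1, h.2⟩, h.1⟩, h.2⟩⟩
  refine ⟨Z, fun z => ?_, ?_, ?_⟩
  · rw [hmem, ← hT, and_iff_right_iff_imp]
    intro hz
    by_contra hS'
    simp [hTS _ hS'] at hz
  · rw [Finset.card_eq_sum_ones, Finset.sum_finset_product_right Z S T hmem]
    calc ∑ y ∈ S, ∑ _x ∈ T y, 1 ≤ ∑ y ∈ S, (linearResultant p q A B).roots.count y :=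
          Finset.sum_le_sum fun y _ => by simpa using hcard y
      _ = (linearResultant p q A B).roots.card := Multiset.toFinset_sum_count_eq _
      _ ≤ _ := card_roots' _
  · rw [Finset.sum_finset_product_right Z S T hmem]
    exact sum_jumps_eq_sub (j := fun y => ∑ x ∈ T y, _) (fun y hy => by simp [hTS y hy])
      hjump hbot htop

section SecondOrder

variable {F : ℝ → ℝ → ℝ} {x₀ y₀ : ℝ} {a b c : ℝ × ℝ → ℝ}

/-- `F` has the expansion `F(x₀, y₀) + a u² + 2 b u v + c v²` at `(x₀, y₀)`, with continuous
coefficients depending on the increment `(u, v)`. -/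
def HasQuadraticExpansion (F : ℝ → ℝ → ℝ) (x₀ y₀ : ℝ) (a b c : ℝ × ℝ → ℝ) : Prop :=
  Continuous a ∧ Continuous b ∧ Continuous c ∧
    ∀ w : ℝ × ℝ, F (x₀ + w.1) (y₀ + w.2) =
      F x₀ y₀ + (a w * w.1 ^ 2 + 2 * b w * w.1 * w.2 + c w * w.2 ^ 2)

theorem HasQuadraticExpansion.neg (h : HasQuadraticExpansion F x₀ y₀ a b c) :
    HasQuadraticExpansion (fun x y => -F x y) x₀ y₀ (fun w => -a w) (fun w => -b w)
      (fun w => -c w) := by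
  obtain ⟨ha, hb, hc, h⟩ := h
  refine ⟨ha.neg, hb.neg, hc.neg, fun w => ?_⟩
  simp only [h]
  ring

theorem HasQuadraticExpansion.isLocMin (h : HasQuadraticExpansion F x₀ y₀ a b c)
    (ha : 0 < a 0) (hdet : 0 < a 0 * c 0 - b 0 ^ 2) : IsLocMin F (x₀, y₀) := by
  obtain ⟨hac, hbc, hcc, h⟩ := h
  have hd : Continuous fun w => a w * c w - b w ^ 2 := by fun_prop
  have hev : ∀ᶠ w in 𝓝 (0 : ℝ × ℝ), F x₀ y₀ ≤ F (x₀ + w.1) (y₀ + w.2) := by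
    filter_upwards [hac.continuousAt.eventually (lt_mem_nhds ha),
      hd.continuousAt.eventually (lt_mem_nhds hdet)] with w haw hdw
    have : 0 ≤ a w * (a w * w.1 ^ 2 + 2 * b w * w.1 * w.2 + c w * w.2 ^ 2) := by
      nlinarith [sq_nonneg (a w * w.1 + b w * w.2), mul_nonneg hdw.le (sq_nonneg w.2)]
    rw [h w]
    linarith [nonneg_of_mul_nonneg_right this haw]
  have ht : Tendsto (fun z : ℝ × ℝ => z - (x₀, y₀)) (𝓝 (x₀, y₀)) (𝓝 0) := by
    have : Continuous fun z : ℝ × ℝ => z - (x₀, y₀) := by fun_prop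
    simpa using this.tendsto (x₀, y₀)
  filter_upwards [ht.eventually hev] with z hz
  simpa using hz

theorem HasQuadraticExpansion.not_isLocMin (h : HasQuadraticExpansion F x₀ y₀ a b c) (u v : ℝ)
    (hneg : a 0 * u ^ 2 + 2 * b 0 * u * v + c 0 * v ^ 2 < 0) : ¬ IsLocMin F (x₀, y₀) := by
  obtain ⟨hac, hbc, hcc, h⟩ := h
  intro hmin
  have hl : Continuous fun t : ℝ => (x₀ + t * u, y₀ + t * v) := by fun_prop
  have hq : Continuous fun t : ℝ => a (t * u, t * v) * u ^ 2 + 2 * b (t * u, t * v) * u * v +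
      c (t * u, t * v) * v ^ 2 := by fun_prop
  have h1 : ∀ᶠ t in 𝓝 (0 : ℝ), F x₀ y₀ ≤ F (x₀ + t * u) (y₀ + t * v) := by
    have := hl.tendsto 0
    simp only [zero_mul, add_zero] at this
    exact this.eventually hmin
  have h2 : ∀ᶠ t in 𝓝 (0 : ℝ), a (t * u, t * v) * u ^ 2 + 2 * b (t * u, t * v) * u * v +
      c (t * u, t * v) * v ^ 2 < 0 :=
    hq.continuousAt.eventually (gt_mem_nhds (by simpa [← Prod.zero_eq_mk] using hneg))
  obtain ⟨t, ⟨ht1, ht2⟩, ht0⟩ := (((h1.and h2).filter_mono nhdsWithin_le_nhds).and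
    (self_mem_nhdsWithin : ∀ᶠ t in 𝓝[≠] (0 : ℝ), t ∈ ({0}ᶜ : Set ℝ))).exists
  rw [h (t * u, t * v)] at ht1
  have : 0 < t ^ 2 := by have : t ≠ 0 := ht0; positivity
  nlinarith [mul_neg_of_pos_of_neg this ht2]

theorem isLocMin_neg {p : ℝ × ℝ} : IsLocMin (fun x y => -F x y) p ↔ IsLocMax F p := by
  simp [IsLocMin, IsLocMax, IsLocalMin, IsLocalMax, IsMinFilter, IsMaxFilter]

theorem HasQuadraticExpansion.not_isLocMin_of_det_neg
    (h : HasQuadraticExpansion F x₀ y₀ a b c)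
    (hdet : a 0 * c 0 - b 0 ^ 2 < 0) : ¬ IsLocMin F (x₀, y₀) := by
  rcases lt_trichotomy (a 0) 0 with ha | ha | ha
  · exact h.not_isLocMin 1 0 (by simpa using ha)
  · rw [ha] at hdet
    have hb : b 0 ≠ 0 := by rintro hb; simp [hb] at hdet
    refine h.not_isLocMin (-(c 0 + 1) / (2 * b 0)) 1 ?_
    have : 2 * b 0 * (-(c 0 + 1) / (2 * b 0)) = -(c 0 + 1) := by field_simp
    rw [ha, this]
    linarith
  · refine h.not_isLocMin (-b 0) (a 0) ?_
    nlinarith [mul_neg_of_pos_of_neg ha hdet]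

/-- The second derivative test in two variables, as a formula for the local index. -/
theorem HasQuadraticExpansion.sign_det (h : HasQuadraticExpansion F x₀ y₀ a b c)
    (hcrit : IsCriticalPt F (x₀, y₀)) (hdet : a 0 * c 0 - b 0 ^ 2 ≠ 0) :
    (SignType.sign (a 0 * c 0 - b 0 ^ 2) = 1 ∧ IsLocMin F (x₀, y₀) ∧
      ¬ IsLocMax F (x₀, y₀) ∧ ¬ IsSaddle F (x₀, y₀)) ∨
    (SignType.sign (a 0 * c 0 - b 0 ^ 2) = 1 ∧ ¬ IsLocMin F (x₀, y₀) ∧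
      IsLocMax F (x₀, y₀) ∧ ¬ IsSaddle F (x₀, y₀)) ∨
    (SignType.sign (a 0 * c 0 - b 0 ^ 2) = -1 ∧ ¬ IsLocMin F (x₀, y₀) ∧
      ¬ IsLocMax F (x₀, y₀) ∧ IsSaddle F (x₀, y₀)) := by
  rcases lt_or_gt_of_ne hdet with hneg | hpos
  · have h1 := h.not_isLocMin_of_det_neg hneg
    have h2 := h.neg.not_isLocMin_of_det_neg (by simpa using hneg)
    rw [isLocMin_neg] at h2
    exact .inr (.inr ⟨sign_neg hneg, h1, h2, hcrit, h1, h2⟩)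
  · rcases lt_trichotomy (a 0) 0 with ha | ha | ha
    · have h1 := h.not_isLocMin 1 0 (by simpa using ha)
      have h2 := h.neg.isLocMin (by simpa using ha) (by simpa using hpos)
      rw [isLocMin_neg] at h2
      exact .inr (.inl ⟨sign_pos hpos, h1, h2, fun hs => hs.2.2 h2⟩)
    · rw [ha] at hpos
      nlinarith [sq_nonneg (b 0)]
    · have h1 := h.isLocMin ha hpos
      have h2 := h.neg.not_isLocMin 1 0 (by simpa using ha)
      rw [isLocMin_neg] at h2
      exact .inl ⟨sign_pos hpos, h1, h2, fun hs => hs.2.1 h1⟩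

end SecondOrder

/-- Counting critical points by type when the local index is known at each of them. -/
theorem euler_number_of_finset {f : ℝ → ℝ → ℝ} {σ : ℝ × ℝ → SignType} (Z : Finset (ℝ × ℝ))
    (hZ : ∀ z, z ∈ Z ↔ IsCriticalPt f z)
    (hσ : ∀ z ∈ Z,
      (σ z = 1 ∧ IsLocMin f z ∧ ¬ IsLocMax f z ∧ ¬ IsSaddle f z) ∨
      (σ z = 1 ∧ ¬ IsLocMin f z ∧ IsLocMax f z ∧ ¬ IsSaddle f z) ∨
      (σ z = -1 ∧ ¬ IsLocMin f z ∧ ¬ IsLocMax f z ∧ IsSaddle f z)) :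
    ({p : ℝ × ℝ | IsCriticalPt f p ∧ IsLocMin f p}.ncard : ℤ) -
      ({p : ℝ × ℝ | IsSaddle f p}.ncard : ℤ) +
      ({p : ℝ × ℝ | IsCriticalPt f p ∧ IsLocMax f p}.ncard : ℤ) = ∑ z ∈ Z, (σ z : ℤ) := by
  classical
  have e1 : {p : ℝ × ℝ | IsCriticalPt f p ∧ IsLocMin f p} = ↑(Z.filter (IsLocMin f)) := by
    ext z; simp [hZ]
  have e2 : {p : ℝ × ℝ | IsSaddle f p} = ↑(Z.filter (IsSaddle f)) := by
    ext z; simp [hZ, IsSaddle]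
  have e3 : {p : ℝ × ℝ | IsCriticalPt f p ∧ IsLocMax f p} = ↑(Z.filter (IsLocMax f)) := by
    ext z; simp [hZ]
  rw [e1, e2, e3]
  simp only [Set.ncard_coe_finset, Finset.card_filter, Nat.cast_sum]
  rw [← Finset.sum_sub_distrib, ← Finset.sum_add_distrib]
  refine Finset.sum_congr rfl fun z hz => ?_
  rcases hσ z hz with ⟨h, h1, h2, h3⟩ | ⟨h, h1, h2, h3⟩ | ⟨h, h1, h2, h3⟩ <;>
    simp [h, h1, h2, h3]

theorem deriv_sextic (a₀ a₁ a₂ a₃ a₄ a₅ a₆ y : ℝ) :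
    deriv (fun t : ℝ => a₀ + a₁ * t + a₂ * t ^ 2 + a₃ * t ^ 3 + a₄ * t ^ 4 + a₅ * t ^ 5 +
      a₆ * t ^ 6) y =
      a₁ + 2 * a₂ * y + 3 * a₃ * y ^ 2 + 4 * a₄ * y ^ 3 + 5 * a₅ * y ^ 4 + 6 * a₆ * y ^ 5 := by
  have : (fun t : ℝ => a₀ + a₁ * t + a₂ * t ^ 2 + a₃ * t ^ 3 + a₄ * t ^ 4 + a₅ * t ^ 5 +
      a₆ * t ^ 6) = fun t => (C a₀ + C a₁ * X + C a₂ * X ^ 2 + C a₃ * X ^ 3 + C a₄ * X ^ 4 +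
        C a₅ * X ^ 5 + C a₆ * X ^ 6).eval t := by
    funext t
    simp
  rw [this, Polynomial.deriv]
  simp
  ring

section J3vers

variable (γ l1 l2 l3 l4 l5 l6 l7 l8 l9 : ℝ)

theorem deriv_J3vers_fst (x y : ℝ) :
    deriv (fun t => J3vers γ l1 l2 l3 l4 l5 l6 l7 l8 l9 t y) x =
      x ^ 2 + (-(2 / 3) * γ * y ^ 2 + 2 * l9 * y) * x +
        (-(1 / 3) * y ^ 4 + l8 * y ^ 2 + l7 * y + l6) := by
  rw [show (fun t => J3vers γ l1 l2 l3 l4 l5 l6 l7 l8 l9 t y) = fun t =>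
      ((1 / 3) * γ * y ^ 6 + l1 + l2 * y + l3 * y ^ 2 + l4 * y ^ 3 + l5 * y ^ 4 -
        3 * l9 * y ^ 5) + (-(1 / 3) * y ^ 4 + l8 * y ^ 2 + l7 * y + l6) * t +
      (-(1 / 3) * γ * y ^ 2 + l9 * y) * t ^ 2 + (1 / 3) * t ^ 3 + 0 * t ^ 4 + 0 * t ^ 5 +
        0 * t ^ 6 by funext t; simp only [J3vers]; ring, deriv_sextic]
  ring

theorem deriv_J3vers_snd (x y : ℝ) :
    deriv (fun t => J3vers γ l1 l2 l3 l4 l5 l6 l7 l8 l9 x t) y =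
      (-(2 / 3) * γ * y + l9) * x ^ 2 + (-(4 / 3) * y ^ 3 + 2 * l8 * y + l7) * x +
        (2 * γ * y ^ 5 - 15 * l9 * y ^ 4 + 4 * l5 * y ^ 3 + 3 * l4 * y ^ 2 + 2 * l3 * y +
          l2) := by
  rw [show (fun t => J3vers γ l1 l2 l3 l4 l5 l6 l7 l8 l9 x t) = fun t =>
      ((1 / 3) * x ^ 3 + l1 + l6 * x) + (l2 + l7 * x + l9 * x ^ 2) * t +
      (-(1 / 3) * γ * x ^ 2 + l3 + l8 * x) * t ^ 2 + l4 * t ^ 3 +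
      (l5 - (1 / 3) * x) * t ^ 4 + (-3 * l9) * t ^ 5 + ((1 / 3) * γ) * t ^ 6 by
    funext t; simp only [J3vers]; ring, deriv_sextic]
  ring

theorem hessDet_J3vers (x y : ℝ) :
    hessDet (J3vers γ l1 l2 l3 l4 l5 l6 l7 l8 l9) (x, y) =
      (2 * x + (-(2 / 3) * γ * y ^ 2 + 2 * l9 * y)) *
        (-(2 / 3) * γ * x ^ 2 + (-4 * y ^ 2 + 2 * l8) * x +
          (10 * γ * y ^ 4 - 60 * l9 * y ^ 3 + 12 * l5 * y ^ 2 + 6 * l4 * y + 2 * l3)) -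
      ((-(4 / 3) * γ * y + 2 * l9) * x + (-(4 / 3) * y ^ 3 + 2 * l8 * y + l7)) ^ 2 := by
  simp only [hessDet, deriv_J3vers_fst, deriv_J3vers_snd]
  congr 1
  · congr 1
    · rw [show (fun t => t ^ 2 + (-(2 / 3) * γ * y ^ 2 + 2 * l9 * y) * t +
          (-(1 / 3) * y ^ 4 + l8 * y ^ 2 + l7 * y + l6)) = fun t =>
          (-(1 / 3) * y ^ 4 + l8 * y ^ 2 + l7 * y + l6) +
          (-(2 / 3) * γ * y ^ 2 + 2 * l9 * y) * t + 1 * t ^ 2 + 0 * t ^ 3 + 0 * t ^ 4 +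
          0 * t ^ 5 + 0 * t ^ 6 by funext t; ring, deriv_sextic]
      ring
    · rw [show (fun y => (-(2 / 3) * γ * y + l9) * x ^ 2 +
          (-(4 / 3) * y ^ 3 + 2 * l8 * y + l7) * x +
          (2 * γ * y ^ 5 - 15 * l9 * y ^ 4 + 4 * l5 * y ^ 3 + 3 * l4 * y ^ 2 + 2 * l3 * y +
            l2)) = fun t => (l9 * x ^ 2 + l7 * x + l2) +
          (-(2 / 3) * γ * x ^ 2 + 2 * l8 * x + 2 * l3) * t + (3 * l4) * t ^ 2 +
          (-(4 / 3) * x + 4 * l5) * t ^ 3 + (-15 * l9) * t ^ 4 + (2 * γ) * t ^ 5 + 0 * t ^ 6 by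
        funext t; ring, deriv_sextic]
      ring
  · congr 1
    rw [show (fun y => x ^ 2 + (-(2 / 3) * γ * y ^ 2 + 2 * l9 * y) * x +
        (-(1 / 3) * y ^ 4 + l8 * y ^ 2 + l7 * y + l6)) = fun t =>
        (x ^ 2 + l6) + (2 * l9 * x + l7) * t + (-(2 / 3) * γ * x + l8) * t ^ 2 + 0 * t ^ 3 +
        (-(1 / 3)) * t ^ 4 + 0 * t ^ 5 + 0 * t ^ 6 by funext t; ring, deriv_sextic]
    ring

theorem J3vers_hasQuadraticExpansion {x y : ℝ}
    (h : IsCriticalPt (J3vers γ l1 l2 l3 l4 l5 l6 l7 l8 l9) (x, y)) :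
    ∃ a b c : ℝ × ℝ → ℝ,
      HasQuadraticExpansion (J3vers γ l1 l2 l3 l4 l5 l6 l7 l8 l9) x y a b c ∧
      hessDet (J3vers γ l1 l2 l3 l4 l5 l6 l7 l8 l9) (x, y) = 4 * (a 0 * c 0 - b 0 ^ 2) := by
  obtain ⟨h1, h2⟩ := h
  simp only [deriv_J3vers_fst, deriv_J3vers_snd] at h1 h2
  refine ⟨fun w => x + w.1 / 3 - γ / 3 * (y + w.2) ^ 2 + l9 * (y + w.2),
    fun _ => x * (-(2 / 3) * γ * y + l9) + (-(4 / 3) * y ^ 3 + 2 * l8 * y + l7) / 2,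
    fun w => -(γ / 3) * (x ^ 2 + 2 * x * w.1) +
      (x + w.1) * (-(1 / 3) * (6 * y ^ 2 + 4 * y * w.2 + w.2 ^ 2) + l8) +
      γ / 3 * (15 * y ^ 4 + 20 * y ^ 3 * w.2 + 15 * y ^ 2 * w.2 ^ 2 + 6 * y * w.2 ^ 3 +
        w.2 ^ 4) + l3 + l4 * (3 * y + w.2) + l5 * (6 * y ^ 2 + 4 * y * w.2 + w.2 ^ 2) -
      3 * l9 * (10 * y ^ 3 + 10 * y ^ 2 * w.2 + 5 * y * w.2 ^ 2 + w.2 ^ 3),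
    ⟨by fun_prop, by fun_prop, by fun_prop, fun w => ?_⟩, ?_⟩
  · simp only [J3vers]
    linear_combination w.1 * h1 + w.2 * h2
  · rw [hessDet_J3vers]
    simp only [Prod.fst_zero, Prod.snd_zero]
    ring

/-- The linear coefficient in `x` of the `x`-derivative of `J3vers`. -/
noncomputable def J3linear : ℝ[X] := C (-(2 / 3) * γ) * X ^ 2 + C (2 * l9) * X

/-- The constant coefficient in `x` of the `x`-derivative of `J3vers`. -/
noncomputable def J3const : ℝ[X] := C (-(1 / 3)) * X ^ 4 + C l8 * X ^ 2 + C l7 * X + C l6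

/-- The quotient of the `y`-derivative of `J3vers` by its `x`-derivative, as polynomials in `x`. -/
noncomputable def J3quotient : ℝ[X] := C (-(2 / 3) * γ) * X + C l9

/-- The linear coefficient of the remainder of the `y`-derivative of `J3vers` modulo its
`x`-derivative, as polynomials in `x`. -/
noncomputable def J3remLinear : ℝ[X] :=
  C (-(4 / 3)) * X ^ 3 + C (2 * l8) * X + C l7 - J3quotient γ l9 * J3linear γ l9

/-- The constant coefficient of the remainder of the `y`-derivative of `J3vers` modulo its
`x`-derivative, as polynomials in `x`. -/
noncomputable def J3remConst : ℝ[X] :=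
  C (2 * γ) * X ^ 5 + C (-15 * l9) * X ^ 4 + C (4 * l5) * X ^ 3 + C (3 * l4) * X ^ 2 +
    C (2 * l3) * X + C l2 - J3quotient γ l9 * J3const l6 l7 l8

theorem natDegree_J3linear_le : (J3linear γ l9).natDegree ≤ 2 := by
  unfold J3linear; compute_degree

theorem natDegree_J3const_le : (J3const l6 l7 l8).natDegree ≤ 4 := by
  unfold J3const; compute_degree

theorem natDegree_J3remLinear_le : (J3remLinear γ l7 l8 l9).natDegree ≤ 3 := by
  unfold J3remLinear J3linear J3quotient; compute_degree

theorem natDegree_J3remConst_le : (J3remConst γ l2 l3 l4 l5 l6 l7 l8 l9).natDegree ≤ 5 := by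
  unfold J3remConst J3const J3quotient; compute_degree

theorem coeff_J3linear : (J3linear γ l9).coeff 2 = -(2 / 3) * γ := by
  simp only [J3linear, coeff_add, coeff_C_mul, coeff_X_pow, coeff_X]
  norm_num

theorem coeff_J3const : (J3const l6 l7 l8).coeff 4 = -(1 / 3) := by
  simp only [J3const, coeff_add, coeff_C_mul, coeff_X_pow, coeff_X, coeff_C]
  norm_num

theorem coeff_J3remLinear :
    (J3remLinear γ l7 l8 l9).coeff 3 = -(4 / 9) * (γ ^ 2 + 3) := by
  have hd : (J3quotient γ l9).natDegree ≤ 1 := by unfold J3quotient; compute_degree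
  have hc := coeff_mul_add_eq_of_natDegree_le hd (natDegree_J3linear_le γ l9)
  norm_num [coeff_J3linear] at hc
  rw [J3remLinear, coeff_sub, hc]
  simp only [J3quotient, coeff_add, coeff_C_mul, coeff_X_pow, coeff_X, coeff_C]
  norm_num
  ring

theorem coeff_J3remConst :
    (J3remConst γ l2 l3 l4 l5 l6 l7 l8 l9).coeff 5 = 16 / 9 * γ := by
  have hd : (J3quotient γ l9).natDegree ≤ 1 := by unfold J3quotient; compute_degree
  have hc := coeff_mul_add_eq_of_natDegree_le hd (natDegree_J3const_le l6 l7 l8)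
  norm_num [coeff_J3const] at hc
  rw [J3remConst, coeff_sub, hc]
  simp only [J3quotient, coeff_add, coeff_C_mul, coeff_X_pow, coeff_X, coeff_C]
  norm_num
  ring

theorem natDegree_linearResultant_J3_le :
    (linearResultant (J3linear γ l9) (J3const l6 l7 l8) (J3remLinear γ l7 l8 l9)
      (J3remConst γ l2 l3 l4 l5 l6 l7 l8 l9)).natDegree ≤ 10 := by
  have hp := natDegree_J3linear_le γ l9
  have hq := natDegree_J3const_le l6 l7 l8
  have hA := natDegree_J3remLinear_le γ l7 l8 l9
  have hB := natDegree_J3remConst_le γ l2 l3 l4 l5 l6 l7 l8 l9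
  unfold linearResultant
  compute_degree
  omega

theorem coeff_linearResultant_J3 :
    (linearResultant (J3linear γ l9) (J3const l6 l7 l8) (J3remLinear γ l7 l8 l9)
      (J3remConst γ l2 l3 l4 l5 l6 l7 l8 l9)).coeff 10 = -(16 / 27) * (γ ^ 2 - 1) ^ 2 := by
  have hp := natDegree_J3linear_le γ l9
  have hq := natDegree_J3const_le l6 l7 l8
  have hA := natDegree_J3remLinear_le γ l7 l8 l9
  have hB := natDegree_J3remConst_le γ l2 l3 l4 l5 l6 l7 l8 l9
  have h1 := coeff_pow_of_natDegree_le (m := 2) hB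
  have h2 := coeff_mul_add_eq_of_natDegree_le
    ((natDegree_mul_le_of_le hp hA)) hB
  have h3 := coeff_mul_add_eq_of_natDegree_le hq (natDegree_pow_le_of_le 2 hA)
  rw [coeff_mul_add_eq_of_natDegree_le hp hA] at h2
  rw [coeff_pow_of_natDegree_le hA] at h3
  norm_num at h1 h2 h3
  rw [linearResultant, coeff_add, coeff_sub, h1, h2, h3, coeff_J3linear, coeff_J3const,
    coeff_J3remLinear, coeff_J3remConst]
  ring

variable {γ l1 l2 l3 l4 l5 l6 l7 l8 l9}

theorem isCriticalPt_J3vers_iff (z : ℝ × ℝ) :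
    IsCriticalPt (J3vers γ l1 l2 l3 l4 l5 l6 l7 l8 l9) z ↔
      z.1 ^ 2 + (J3linear γ l9).eval z.2 * z.1 + (J3const l6 l7 l8).eval z.2 = 0 ∧
      (J3remLinear γ l7 l8 l9).eval z.2 * z.1 +
        (J3remConst γ l2 l3 l4 l5 l6 l7 l8 l9).eval z.2 = 0 := by
  simp only [IsCriticalPt, deriv_J3vers_fst, deriv_J3vers_snd, J3linear, J3const, J3remLinear,
    J3remConst, J3quotient, eval_add, eval_sub, eval_mul, eval_pow, eval_C, eval_X]
  refine ⟨fun h => ⟨by linear_combination h.1, ?_⟩, fun h => ⟨by linear_combination h.1, ?_⟩⟩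
  · linear_combination h.2 - (-(2 / 3) * γ * z.2 + l9) * h.1
  · linear_combination h.2 + (-(2 / 3) * γ * z.2 + l9) * h.1

theorem hessDet_J3vers_eq_linearJacobian {x y : ℝ}
    (h : IsCriticalPt (J3vers γ l1 l2 l3 l4 l5 l6 l7 l8 l9) (x, y)) :
    hessDet (J3vers γ l1 l2 l3 l4 l5 l6 l7 l8 l9) (x, y) =
      linearJacobian (J3linear γ l9) (J3const l6 l7 l8) (J3remLinear γ l7 l8 l9)
        (J3remConst γ l2 l3 l4 l5 l6 l7 l8 l9) x y := by
  have h1 := h.1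
  simp only [deriv_J3vers_fst] at h1
  rw [hessDet_J3vers]
  simp only [linearJacobian, J3linear, J3const, J3remLinear, J3remConst, J3quotient,
    derivative_add, derivative_sub, derivative_mul, derivative_C, derivative_X,
    derivative_X_pow, eval_add, eval_sub, eval_mul, eval_pow, eval_C, eval_X, eval_zero, eval_one]
  push_cast
  linear_combination (2 * x + (-(2 / 3) * γ * y ^ 2 + 2 * l9 * y)) * (-(2 / 3) * γ) * h1

theorem linearResultant_J3_degree (hγ : γ ∈ Set.Ioo (-1 : ℝ) 1) :
    (linearResultant (J3linear γ l9) (J3const l6 l7 l8) (J3remLinear γ l7 l8 l9)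
      (J3remConst γ l2 l3 l4 l5 l6 l7 l8 l9)).natDegree = 10 ∧
    (linearResultant (J3linear γ l9) (J3const l6 l7 l8) (J3remLinear γ l7 l8 l9)
      (J3remConst γ l2 l3 l4 l5 l6 l7 l8 l9)).leadingCoeff < 0 := by
  have hc := coeff_linearResultant_J3 γ l2 l3 l4 l5 l6 l7 l8 l9
  have hne : γ ^ 2 - 1 ≠ 0 := by nlinarith [hγ.1, hγ.2]
  have hneg : -(16 / 27) * (γ ^ 2 - 1) ^ 2 < 0 := by
    have : 0 < (γ ^ 2 - 1) ^ 2 := by positivity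
    linarith
  have hd := natDegree_eq_of_le_of_coeff_ne_zero
    (natDegree_linearResultant_J3_le γ l2 l3 l4 l5 l6 l7 l8 l9) (hc ▸ hneg.ne)
  exact ⟨hd, by rwa [leadingCoeff, hd, hc]⟩

theorem J3remLinear_degree :
    (J3remLinear γ l7 l8 l9).natDegree = 3 ∧ (J3remLinear γ l7 l8 l9).leadingCoeff < 0 := by
  have hc := coeff_J3remLinear γ l7 l8 l9
  have hneg : -(4 / 9) * (γ ^ 2 + 3) < 0 := by nlinarith [sq_nonneg γ]
  have hd := natDegree_eq_of_le_of_coeff_ne_zero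
    (natDegree_J3remLinear_le γ l7 l8 l9) (hc ▸ hneg.ne)
  exact ⟨hd, by rwa [leadingCoeff, hd, hc]⟩

theorem eventually_atTop_jumpFunction_J3 (hγ : γ ∈ Set.Ioo (-1 : ℝ) 1) :
    ∀ᶠ t in atTop, jumpFunction (J3linear γ l9) (J3const l6 l7 l8) (J3remLinear γ l7 l8 l9)
      (J3remConst γ l2 l3 l4 l5 l6 l7 l8 l9) t = -1 := by
  filter_upwards [eventually_atTop_sign_eval (linearResultant (J3linear γ l9) (J3const l6 l7 l8)
      (J3remLinear γ l7 l8 l9) (J3remConst γ l2 l3 l4 l5 l6 l7 l8 l9)),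
    eventually_atTop_sign_eval (J3remLinear γ l7 l8 l9)] with t h1 h2
  rw [sign_neg (linearResultant_J3_degree hγ).2] at h1
  rw [sign_neg J3remLinear_degree.2] at h2
  simp [jumpFunction, signJump, h1, h2]

theorem eventually_atBot_jumpFunction_J3 (hγ : γ ∈ Set.Ioo (-1 : ℝ) 1) :
    ∀ᶠ t in atBot, jumpFunction (J3linear γ l9) (J3const l6 l7 l8) (J3remLinear γ l7 l8 l9)
      (J3remConst γ l2 l3 l4 l5 l6 l7 l8 l9) t = 1 := by
  filter_upwards [eventually_atBot_sign_eval (linearResultant (J3linear γ l9) (J3const l6 l7 l8)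
      (J3remLinear γ l7 l8 l9) (J3remConst γ l2 l3 l4 l5 l6 l7 l8 l9)),
    eventually_atBot_sign_eval (J3remLinear γ l7 l8 l9)] with t h1 h2
  rw [sign_neg (linearResultant_J3_degree hγ).2, (linearResultant_J3_degree hγ).1] at h1
  rw [sign_neg J3remLinear_degree.2, J3remLinear_degree.1] at h2
  rw [jumpFunction, h1, h2]
  decide

end J3vers

/-- A Morse polynomial of the canonical versal deformation of `J₁₀³` (with
`γ ∈ (−1,1)`) has a finite set of critical points, at most ten of them, its Euler
number `m₋ − m× + m₊` equals `−2`, and the total number of real critical points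
is even. -/
theorem J3vers_euler_number (γ l1 l2 l3 l4 l5 l6 l7 l8 l9 : ℝ)
    (hγ : γ ∈ Set.Ioo (-1 : ℝ) 1)
    (hnd : ∀ p : ℝ × ℝ, IsCriticalPt (J3vers γ l1 l2 l3 l4 l5 l6 l7 l8 l9) p →
      hessDet (J3vers γ l1 l2 l3 l4 l5 l6 l7 l8 l9) p ≠ 0) :
    {p : ℝ × ℝ | IsCriticalPt (J3vers γ l1 l2 l3 l4 l5 l6 l7 l8 l9) p}.Finite ∧
    {p : ℝ × ℝ | IsCriticalPt (J3vers γ l1 l2 l3 l4 l5 l6 l7 l8 l9) p}.ncard ≤ 10 ∧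
    ({p : ℝ × ℝ | IsCriticalPt (J3vers γ l1 l2 l3 l4 l5 l6 l7 l8 l9) p ∧
        IsLocMin (J3vers γ l1 l2 l3 l4 l5 l6 l7 l8 l9) p}.ncard : ℤ) -
      ({p : ℝ × ℝ | IsSaddle (J3vers γ l1 l2 l3 l4 l5 l6 l7 l8 l9) p}.ncard : ℤ) +
      ({p : ℝ × ℝ | IsCriticalPt (J3vers γ l1 l2 l3 l4 l5 l6 l7 l8 l9) p ∧
        IsLocMax (J3vers γ l1 l2 l3 l4 l5 l6 l7 l8 l9) p}.ncard : ℤ) = -2 ∧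
    Even ({p : ℝ × ℝ | IsCriticalPt (J3vers γ l1 l2 l3 l4 l5 l6 l7 l8 l9) p ∧
        IsLocMin (J3vers γ l1 l2 l3 l4 l5 l6 l7 l8 l9) p}.ncard +
      {p : ℝ × ℝ | IsSaddle (J3vers γ l1 l2 l3 l4 l5 l6 l7 l8 l9) p}.ncard +
      {p : ℝ × ℝ | IsCriticalPt (J3vers γ l1 l2 l3 l4 l5 l6 l7 l8 l9) p ∧
        IsLocMax (J3vers γ l1 l2 l3 l4 l5 l6 l7 l8 l9) p}.ncard) := by
  have hndJ : ∀ x y, x ^ 2 + (J3linear γ l9).eval y * x + (J3const l6 l7 l8).eval y = 0 ∧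
      (J3remLinear γ l7 l8 l9).eval y * x +
        (J3remConst γ l2 l3 l4 l5 l6 l7 l8 l9).eval y = 0 →
      linearJacobian (J3linear γ l9) (J3const l6 l7 l8) (J3remLinear γ l7 l8 l9)
        (J3remConst γ l2 l3 l4 l5 l6 l7 l8 l9) x y ≠ 0 := fun x y h => by
    have hc := (isCriticalPt_J3vers_iff (l1 := l1) (x, y)).2 h
    rw [← hessDet_J3vers_eq_linearJacobian hc]
    exact hnd _ hc
  obtain ⟨hdeg, hlead⟩ := linearResultant_J3_degree (l2 := l2) (l3 := l3) (l4 := l4) (l5 := l5)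
    (l6 := l6) (l7 := l7) (l8 := l8) (l9 := l9) hγ
  obtain ⟨Z, hZ, hcard, hsum⟩ := exists_finset_sum_sign_linearJacobian
    (leadingCoeff_ne_zero.1 hlead.ne) hndJ (eventually_atBot_jumpFunction_J3 hγ)
    (eventually_atTop_jumpFunction_J3 hγ)
  have hZc : ∀ z, z ∈ Z ↔ IsCriticalPt (J3vers γ l1 l2 l3 l4 l5 l6 l7 l8 l9) z := fun z =>
    (hZ z).trans (isCriticalPt_J3vers_iff z).symm
  have hset : {p : ℝ × ℝ | IsCriticalPt (J3vers γ l1 l2 l3 l4 l5 l6 l7 l8 l9) p} = ↑Z := by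
    ext z
    simp [hZc]
  have heuler := euler_number_of_finset Z hZc
    (σ := fun z => SignType.sign (linearJacobian (J3linear γ l9) (J3const l6 l7 l8)
      (J3remLinear γ l7 l8 l9) (J3remConst γ l2 l3 l4 l5 l6 l7 l8 l9) z.1 z.2)) <| by
    rintro ⟨x, y⟩ hz
    have hc := (hZc _).1 hz
    have h0 := hnd _ hc
    obtain ⟨a, b, c, hexp, hdet⟩ := J3vers_hasQuadraticExpansion γ l1 l2 l3 l4 l5 l6 l7 l8 l9 hc
    have := hexp.sign_det hc (fun h => h0 (by rw [hdet, h, mul_zero]))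
    have hsign : SignType.sign (a 0 * c 0 - b 0 ^ 2) =
        SignType.sign (hessDet (J3vers γ l1 l2 l3 l4 l5 l6 l7 l8 l9) (x, y)) := by
      rw [hdet, sign_mul, sign_pos four_pos, one_mul]
    rwa [hsign, hessDet_J3vers_eq_linearJacobian hc] at this
  rw [hsum] at heuler
  rw [hset]
  refine ⟨Z.finite_toSet, ?_, heuler, ?_⟩
  · rw [Set.ncard_coe_finset]
    exact hcard.trans_eq hdeg
  · rw [Nat.even_iff]
    omega
end
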